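/- arXiv:2108.00247 — 2 statements merged into one kernel-verified Lean document; each statement's English description precedes it below -/
import Mathlib

section
/- Let d≥2, β≥-1/2, γ>-1 and α=β+(d-1)/2. There exists a constant c>0 depending only on β, γ and d such that for every measurable g:𝕌₀×𝕌→ℝ with g((√t,t),·)∈L¹(𝕌;U_{γ,α}(z)dz) for each t∈[0,1], and for every (x,t)∈𝕍₀^{d+1}: ∫_{𝕍₀^{d+1}} |T_{β,γ}g((x,t),(y,s))|·ϖ_{β,γ}(s) dσ(y,s) ≤ c·∫_𝕌 |g((√t,t),z)|·U_{γ,α}(z) dz. -/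
open MeasureTheory Real Filter Set
open scoped RealInnerProductSpace ENNReal

noncomputable section

/-- Pochhammer symbol `(a)_n = a(a+1)⋯(a+n-1)`. -/
def poch (a : ℝ) (n : ℕ) : ℝ := ∏ i ∈ Finset.range n, (a + i)

/-- Jacobi polynomial `P_n^{(a,b)}(t)` via its hypergeometric expansion. -/
def jacobiP (n : ℕ) (a b : ℝ) (t : ℝ) : ℝ :=
  (poch (a + 1) n / (n.factorial : ℝ)) *
    ∑ j ∈ Finset.range (n + 1),
      (poch (-(n : ℝ)) j * poch ((n : ℝ) + a + b + 1) j) /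
        (poch (a + 1) j * (j.factorial : ℝ)) * ((1 - t) / 2) ^ j

/-- Squared norm `h_n^{(a,b)}` of the Jacobi polynomials. -/
def hJ (n : ℕ) (a b : ℝ) : ℝ :=
  (poch (a + 1) n * poch (b + 1) n * (a + b + (n : ℝ) + 1)) /
    ((n.factorial : ℝ) * poch (a + b + 2) n * (a + b + 2 * (n : ℝ) + 1))

/-- Normalization constant `c_{a,b}` of the Jacobi weight. -/
def cJ (a b : ℝ) : ℝ := Real.Gamma (a + b + 2) / (Real.Gamma (a + 1) * Real.Gamma (b + 1))

/-- Generalized binomial coefficient `C(n+δ, n) = (δ+1)_n/n!`. -/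
def binomC (δ : ℝ) (n : ℕ) : ℝ := poch (δ + 1) n / (n.factorial : ℝ)

/-- The parabolic domain `𝕌 = {(x₁,x₂) : x₁² ≤ x₂ ≤ 1}`. -/
def Udom : Set (ℝ × ℝ) := {x | x.1 ^ 2 ≤ x.2 ∧ x.2 ≤ 1}

/-- The curved part `𝕌₀` of the boundary of `𝕌`. -/
def Udom0 : Set (ℝ × ℝ) := {x ∈ Udom | x.2 = x.1 ^ 2}

/-- The weight `U_{a,b}` on the parabolic domain. -/
def Uw (a b : ℝ) (x : ℝ × ℝ) : ℝ := (1 - x.2) ^ a * (x.2 - x.1 ^ 2) ^ (b - 1/2)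

/-- Normalization constant `d_{a,b}` of `U_{a,b}`. -/
def dU (a b : ℝ) : ℝ := (∫ x in Udom, Uw a b x)⁻¹

/-- The weighted measure `U_{a,b}(x) dx` on `𝕌`. -/
def μU (a b : ℝ) : Measure (ℝ × ℝ) :=
  (volume.restrict Udom).withDensity fun x => ENNReal.ofReal (Uw a b x)

/-- The orthogonal basis `P_{k,n}^{a,b}` on the parabolic domain (with the continuous
extension to `x₂ = 0`, where in Lean `x₁/√x₂ = 0` and `(√x₂)^k = 0` for `k ≥ 1`). -/
def PknU (a b : ℝ) (k n : ℕ) (x : ℝ × ℝ) : ℝ :=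
  jacobiP (n - k) (b + (k : ℝ)) a (1 - 2 * x.2) * (Real.sqrt x.2) ^ k *
    jacobiP k (b - 1/2) (b - 1/2) (x.1 / Real.sqrt x.2)

/-- Squared norms `h_{k,n}^{a,b}`. -/
def hknU (a b : ℝ) (k n : ℕ) : ℝ :=
  (cJ b a / cJ (b + (k : ℝ)) a) * hJ (n - k) (b + (k : ℝ)) a * hJ k (b - 1/2) (b - 1/2)

/-- Reproducing kernel `P_n(U_{a,b}; x, y)` on the parabolic domain. -/
def PnU (a b : ℝ) (n : ℕ) (x y : ℝ × ℝ) : ℝ :=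
  ∑ k ∈ Finset.range (n + 1), PknU a b k n x * PknU a b k n y / hknU a b k n

/-- Partial-sum kernel `K_n(U_{a,b}; x, y)`. -/
def KnU (a b : ℝ) (n : ℕ) (x y : ℝ × ℝ) : ℝ :=
  ∑ m ∈ Finset.range (n + 1), PnU a b m x y

/-- Cesàro `(C,δ)` kernel `K_n^δ(U_{a,b}; x, y)`. -/
def KnUCes (a b δ : ℝ) (n : ℕ) (x y : ℝ × ℝ) : ℝ :=
  (binomC δ n)⁻¹ * ∑ m ∈ Finset.range (n + 1), binomC (δ - 1) (n - m) * KnU a b m x y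

/-- Cesàro `(C,δ)` means `S_n^δ(U_{a,b}; f, x)`. -/
def SnUCes (a b δ : ℝ) (n : ℕ) (f : ℝ × ℝ → ℝ) (x : ℝ × ℝ) : ℝ :=
  dU a b * ∫ y in Udom, f y * KnUCes a b δ n x y * Uw a b y

/-- `Z_m^λ`, the normalized Gegenbauer polynomial (`2T_m` in the limiting case `λ = 0`). -/
def Zm (lam : ℝ) (m : ℕ) (t : ℝ) : ℝ :=
  if lam = 0 then (if m = 0 then 1 else 2 * (Polynomial.Chebyshev.T ℝ (m : ℤ)).eval t)
  else ((m : ℝ) + lam) / lam * (poch (2 * lam) m / poch (lam + 1/2) m) *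
    jacobiP m (lam - 1/2) (lam - 1/2) t

/-- Euclidean space `ℝ^d`. -/
abbrev Euc (d : ℕ) := EuclideanSpace ℝ (Fin d)

/-- The surface measure on the unit sphere `𝕊^{d-1}`. -/
def sphMeas (d : ℕ) : Measure (Metric.sphere (0 : Euc d) 1) :=
  (volume : Measure (Euc d)).toSphere

/-- The surface area `ω_d` of the unit sphere. -/
def ωd (d : ℕ) : ℝ := (sphMeas d Set.univ).toReal

/-- Integral over the unit sphere. -/
def sphInt (d : ℕ) (f : Euc d → ℝ) : ℝ := ∫ ξ, f (ξ : Euc d) ∂(sphMeas d)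

/-- Integral over the surface of the paraboloid `𝕍₀^{d+1}`:
`∫_{𝕍₀} f dσ = ∫_0^1 t^{(d-1)/2} ∫_{𝕊^{d-1}} f(√t ξ, t) dσ_𝕊(ξ) dt`. -/
def V0Int (d : ℕ) (f : Euc d → ℝ → ℝ) : ℝ :=
  ∫ t in (0:ℝ)..1, t ^ (((d : ℝ) - 1) / 2) * ∫ ξ, f (Real.sqrt t • (ξ : Euc d)) t ∂(sphMeas d)

/-- The weight `ϖ_{β,γ}(t) = t^β (1-t)^γ`. -/
def wt (β γ : ℝ) (t : ℝ) : ℝ := t ^ β * (1 - t) ^ γ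

/-- Normalization constant `b_{β,γ}` on the surface of the paraboloid. -/
def bV0 (d : ℕ) (β γ : ℝ) : ℝ := (V0Int d fun _ t => wt β γ t)⁻¹

/-- The surface of the paraboloid `𝕍₀^{d+1} = {(x,t) : ‖x‖² = t ≤ 1}`. -/
def V0set (d : ℕ) : Set (Euc d × ℝ) := {q | ‖q.1‖ ^ 2 = q.2 ∧ q.2 ≤ 1}

/-- The weighted measure `ϖ_{β,γ} dσ` on (the sphere-parametrization of) `𝕍₀^{d+1}`. -/
def μV0 (d : ℕ) (β γ : ℝ) : Measure (Metric.sphere (0 : Euc d) 1 × ℝ) :=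
  ((sphMeas d).prod (volume.restrict (Set.Icc (0:ℝ) 1))).withDensity
    fun p => ENNReal.ofReal (p.2 ^ (((d : ℝ) - 1) / 2) * wt β γ p.2)

/-- Squared norms `h_{m,n}^{β,γ}` on the surface of the paraboloid. -/
def hV0 (d : ℕ) (β γ : ℝ) (m n : ℕ) : ℝ :=
  (cJ (β + ((d : ℝ) - 1) / 2) γ / cJ ((m : ℝ) + β + ((d : ℝ) - 1) / 2) γ) *
    hJ (n - m) ((m : ℝ) + β + ((d : ℝ) - 1) / 2) γ

/-- The reproducing kernel `P_n(ϖ_{β,γ}; (√t ξ, t), (√s η, s))` on `𝕍₀^{d+1}`,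
written as a function of `t`, `s` and `c = ⟨ξ,η⟩`. -/
def PnV0 (d : ℕ) (β γ : ℝ) (n : ℕ) (t s c : ℝ) : ℝ :=
  ∑ m ∈ Finset.range (n + 1),
    jacobiP (n - m) ((m : ℝ) + β + ((d : ℝ) - 1) / 2) γ (1 - 2 * t) *
      jacobiP (n - m) ((m : ℝ) + β + ((d : ℝ) - 1) / 2) γ (1 - 2 * s) / hV0 d β γ m n *
      (Real.sqrt t) ^ m * (Real.sqrt s) ^ m * Zm (((d : ℝ) - 2) / 2) m c

/-- Partial-sum kernel `K_n(ϖ_{β,γ})` on `𝕍₀^{d+1}`. -/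
def KnV0 (d : ℕ) (β γ : ℝ) (n : ℕ) (t s c : ℝ) : ℝ :=
  ∑ m ∈ Finset.range (n + 1), PnV0 d β γ m t s c

/-- Cesàro `(C,δ)` kernel on `𝕍₀^{d+1}`. -/
def KnV0Ces (d : ℕ) (β γ δ : ℝ) (n : ℕ) (t s c : ℝ) : ℝ :=
  (binomC δ n)⁻¹ * ∑ m ∈ Finset.range (n + 1), binomC (δ - 1) (n - m) * KnV0 d β γ m t s c

/-- Cesàro `(C,δ)` means `S_n^δ(ϖ_{β,γ}; f, (√t ξ, t))` on `𝕍₀^{d+1}`. -/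
def SnV0Ces (d : ℕ) (β γ δ : ℝ) (n : ℕ) (f : Euc d × ℝ → ℝ) (ξ : Euc d) (t : ℝ) : ℝ :=
  bV0 d β γ * ∫ s in (0:ℝ)..1, s ^ (((d : ℝ) - 1) / 2) * wt β γ s *
    ∫ η, f (Real.sqrt s • (η : Euc d), s) * KnV0Ces d β γ δ n t s ⟪ξ, (η : Euc d)⟫ ∂(sphMeas d)

/-- Normalization constant `τ_β` in the definition of `T_{β,γ}`. -/
def τβ (d : ℕ) (β : ℝ) : ℝ :=
  (∫ z₁ in (-1:ℝ)..1, ∫ z₂ in (-1:ℝ)..1,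
    (1 - z₁) ^ (((d : ℝ) - 2) / 2) * (1 + z₁) ^ (β - 1/2) * (1 - z₂ ^ 2) ^ β)⁻¹

/-- The operator `T_{β,γ}` on the surface of the paraboloid, with
`(x,t) = (√t ξ, t)` and `(y,s) = (√s η, s)`. -/
def TV0 (d : ℕ) (β γ : ℝ) (g : ℝ × ℝ → ℝ × ℝ → ℝ) (ξ η : Euc d) (t s : ℝ) : ℝ :=
  if β = -(1/2) then g (Real.sqrt t, t) (⟪ξ, Real.sqrt s • η⟫, s)
  else τβ d β * ∫ z₁ in (-1:ℝ)..1, ∫ z₂ in (-1:ℝ)..1,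
    g (Real.sqrt t, t) (Real.sqrt s * ((1 - z₁) / 2 * ⟪ξ, η⟫ + (1 + z₁) / 2 * z₂), s) *
      ((1 - z₁) ^ (((d : ℝ) - 2) / 2) * (1 + z₁) ^ (β - 1/2) * (1 - z₂ ^ 2) ^ β)

/-- The pseudo convolution `f ∗_{𝕍₀} g` on the surface of the paraboloid. -/
def convV0 (d : ℕ) (β γ : ℝ) (f : Euc d × ℝ → ℝ) (g : ℝ × ℝ → ℝ × ℝ → ℝ)
    (η : Euc d) (s : ℝ) : ℝ :=
  bV0 d β γ * ∫ t in (0:ℝ)..1, t ^ (((d : ℝ) - 1) / 2) * wt β γ t *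
    ∫ ξ, f (Real.sqrt t • (ξ : Euc d), t) * TV0 d β γ g (ξ : Euc d) η t s ∂(sphMeas d)

/-- The solid paraboloid `𝕍^{d+1} = {(x,t) : ‖x‖² ≤ t ≤ 1}`. -/
def Vset (d : ℕ) : Set (Euc d × ℝ) := {q | ‖q.1‖ ^ 2 ≤ q.2 ∧ q.2 ≤ 1}

/-- The weight `W_{β,γ,μ}` on the solid paraboloid. -/
def WW (d : ℕ) (β γ μ : ℝ) (q : Euc d × ℝ) : ℝ :=
  q.2 ^ β * (1 - q.2) ^ γ * (q.2 - ‖q.1‖ ^ 2) ^ (μ - 1/2)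

/-- Normalization constant `b_{β,γ,μ}`. -/
def bW (d : ℕ) (β γ μ : ℝ) : ℝ := (∫ q in Vset d, WW d β γ μ q)⁻¹

/-- The weighted measure `W_{β,γ,μ}(x,t) dx dt` on `𝕍^{d+1}`. -/
def μW (d : ℕ) (β γ μ : ℝ) : Measure (Euc d × ℝ) :=
  (volume.restrict (Vset d)).withDensity fun q => ENNReal.ofReal (WW d β γ μ q)

/-- The weight `ϖ_μ(y) = (1-‖y‖²)^{μ-1/2}` on the unit ball. -/
def wB (d : ℕ) (μ : ℝ) (y : Euc d) : ℝ := (1 - ‖y‖ ^ 2) ^ (μ - 1/2)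

/-- Normalization constant `b_μ` of `ϖ_μ` on the unit ball. -/
def bB (d : ℕ) (μ : ℝ) : ℝ := (∫ y in Metric.closedBall (0 : Euc d) 1, wB d μ y)⁻¹

/-- Normalization constant `σ_μ = (∫_{-1}^1 (1-u²)^{μ-1} du)⁻¹`. -/
def σμ (μ : ℝ) : ℝ := (∫ u in (-1:ℝ)..1, (1 - u ^ 2) ^ (μ - 1))⁻¹

/-- `ξ₀(x,t,y,s;u) = (⟨x,y⟩ + u √(t-‖x‖²) √(s-‖y‖²))/√(st)`. -/
def xi0 (d : ℕ) (x : Euc d) (t : ℝ) (y : Euc d) (s : ℝ) (u : ℝ) : ℝ :=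
  (⟪x, y⟫ + u * Real.sqrt (t - ‖x‖ ^ 2) * Real.sqrt (s - ‖y‖ ^ 2)) / Real.sqrt (s * t)

/-- Squared norms `h_{m,n}^{β,γ,μ}` on the solid paraboloid. -/
def hW (d : ℕ) (β γ μ : ℝ) (m n : ℕ) : ℝ :=
  (cJ (β + μ + ((d : ℝ) - 1) / 2) γ / cJ ((m : ℝ) + β + μ + ((d : ℝ) - 1) / 2) γ) *
    hJ (n - m) ((m : ℝ) + β + μ + ((d : ℝ) - 1) / 2) γ

/-- The reproducing kernel `P_n(W_{β,γ,μ}; (x,t), (y,s))` on the solid paraboloid. -/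
def PnW (d : ℕ) (β γ μ : ℝ) (n : ℕ) (x : Euc d) (t : ℝ) (y : Euc d) (s : ℝ) : ℝ :=
  σμ μ * ∫ u in (-1:ℝ)..1,
    (∑ m ∈ Finset.range (n + 1),
      jacobiP (n - m) ((m : ℝ) + β + μ + ((d : ℝ) - 1) / 2) γ (1 - 2 * t) *
        jacobiP (n - m) ((m : ℝ) + β + μ + ((d : ℝ) - 1) / 2) γ (1 - 2 * s) / hW d β γ μ m n *
        (Real.sqrt t) ^ m * (Real.sqrt s) ^ m *
        Zm (μ + ((d : ℝ) - 1) / 2) m (xi0 d x t y s u)) * (1 - u ^ 2) ^ (μ - 1)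

/-- Partial-sum kernel `K_n(W_{β,γ,μ})`. -/
def KnW (d : ℕ) (β γ μ : ℝ) (n : ℕ) (x : Euc d) (t : ℝ) (y : Euc d) (s : ℝ) : ℝ :=
  ∑ m ∈ Finset.range (n + 1), PnW d β γ μ m x t y s

/-- Cesàro `(C,δ)` kernel on the solid paraboloid. -/
def KnWCes (d : ℕ) (β γ μ δ : ℝ) (n : ℕ) (x : Euc d) (t : ℝ) (y : Euc d) (s : ℝ) : ℝ :=
  (binomC δ n)⁻¹ * ∑ m ∈ Finset.range (n + 1), binomC (δ - 1) (n - m) * KnW d β γ μ m x t y s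

/-- Cesàro `(C,δ)` means `S_n^δ(W_{β,γ,μ}; f, (x,t))`. -/
def SnWCes (d : ℕ) (β γ μ δ : ℝ) (n : ℕ) (f : Euc d × ℝ → ℝ) (x : Euc d) (t : ℝ) : ℝ :=
  bW d β γ μ * ∫ q in Vset d, f q * KnWCes d β γ μ δ n x t q.1 q.2 * WW d β γ μ q

/-- `ξ(x,t,y,s;z,u)` in the connection kernel on the solid paraboloid. -/
def ξW (d : ℕ) (x : Euc d) (t : ℝ) (y : Euc d) (s : ℝ) (z₁ z₂ u : ℝ) : ℝ :=
  (1 - z₁) / 2 * xi0 d x t y s u + (1 + z₁) / 2 * z₂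

/-- Normalization constant `κ_β`. -/
def κβ (d : ℕ) (β μ : ℝ) : ℝ :=
  (∫ z₁ in (-1:ℝ)..1, ∫ z₂ in (-1:ℝ)..1, ∫ u in (-1:ℝ)..1,
    (1 - z₁) ^ (μ + ((d : ℝ) - 1) / 2) * (1 + z₁) ^ (β - 1) * (1 - z₂ ^ 2) ^ (β - 1/2) *
      (1 - u ^ 2) ^ (μ - 1))⁻¹

/-- The operator `T_{β,γ,μ}` on the solid paraboloid. -/
def TW (d : ℕ) (β γ μ : ℝ) (g : ℝ × ℝ → ℝ × ℝ → ℝ) (x : Euc d) (t : ℝ) (y : Euc d) (s : ℝ) : ℝ :=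
  if β = 0 then
    σμ μ * ∫ u in (-1:ℝ)..1,
      g (Real.sqrt t, t) (Real.sqrt s * xi0 d x t y s u, s) * (1 - u ^ 2) ^ (μ - 1)
  else
    κβ d β μ * ∫ z₁ in (-1:ℝ)..1, ∫ z₂ in (-1:ℝ)..1, ∫ u in (-1:ℝ)..1,
      g (Real.sqrt t, t) (Real.sqrt s * ξW d x t y s z₁ z₂ u, s) *
        ((1 - z₁) ^ (μ + ((d : ℝ) - 1) / 2) * (1 + z₁) ^ (β - 1) * (1 - z₂ ^ 2) ^ (β - 1/2) *
          (1 - u ^ 2) ^ (μ - 1))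

/-- Directional derivative `⟨x,∇⟩f(x) = ∑ xᵢ ∂ᵢ f(x)`. -/
def xGrad (d : ℕ) (f : Euc d → ℝ) (x : Euc d) : ℝ := fderiv ℝ f x x

/-- Laplacian `Δf(x) = ∑ ∂ᵢ² f(x)`. -/
def lapl (d : ℕ) (f : Euc d → ℝ) (x : Euc d) : ℝ :=
  ∑ i : Fin d, fderiv ℝ (fun y => fderiv ℝ f y (EuclideanSpace.single i 1)) x
    (EuclideanSpace.single i 1)


/-- `Q_{m,n}(x,t) = P_{n-m}^{(m+α,γ)}(1-2t) t^{m/2} Y(x/√t)`. -/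
def QV0gen (d : ℕ) (α γ : ℝ) (m n : ℕ) (Y : Euc d → ℝ) (x : Euc d) (t : ℝ) : ℝ :=
  jacobiP (n - m) ((m : ℝ) + α) γ (1 - 2 * t) * (Real.sqrt t) ^ m * Y ((Real.sqrt t)⁻¹ • x)

end


lemma poch_succ (x : ℝ) (n : ℕ) : poch x (n+1) = poch x n * (x + n) := by
  simp [poch, Finset.prod_range_succ]

lemma poch_succ' (x : ℝ) (n : ℕ) : poch x (n+1) = x * poch (x+1) n := by
  simp only [poch, Finset.prod_range_succ']
  push_cast
  rw [mul_comm]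
  congr 1
  · ring
  · apply Finset.prod_congr rfl; intros; ring

lemma poch_zero' (x : ℝ) : poch x 0 = 1 := by simp [poch]

lemma poch_pos' {x : ℝ} (hx : 0 < x) (n : ℕ) : 0 < poch x n := by
  unfold poch; apply Finset.prod_pos; intros; positivity

noncomputable def hagA (j : ℕ) (x : ℝ) : ℝ := poch (x + j + 1) j / (j.factorial : ℝ)

noncomputable def hagB (j : ℕ) (x : ℝ) : ℝ := match j with
  | 0 => 1
  | j+1 => x * poch (x + j + 2) j / ((j+1).factorial : ℝ)

lemma hagA_zero (x : ℝ) : hagA 0 x = 1 := by simp [hagA, poch]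
lemma hagB_zero (x : ℝ) : hagB 0 x = 1 := by simp [hagB]
lemma hagB_at_zero (j : ℕ) : hagB (j+1) 0 = 0 := by simp [hagB]

lemma hagA_pascal (j : ℕ) (x : ℝ) : hagA (j+1) x = hagA (j+1) (x-1) + hagA j (x+1) := by
  unfold hagA
  rw [poch_succ (x + ((j+1:ℕ):ℝ) + 1), poch_succ' (x - 1 + ((j+1:ℕ):ℝ) + 1), Nat.factorial_succ]
  have e1 : x - 1 + ((j+1:ℕ):ℝ) + 1 + 1 = x + ((j+1:ℕ):ℝ) + 1 := by ring
  have e2 : x + 1 + (j:ℝ) + 1 = x + ((j+1:ℕ):ℝ) + 1 := by push_cast; ring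
  rw [e1, e2]
  have : (j.factorial : ℝ) ≠ 0 := by positivity
  push_cast
  field_simp
  ring

lemma hagB_pascal (j : ℕ) (x : ℝ) : hagB (j+1) x = hagB (j+1) (x-1) + hagB j (x+1) := by
  cases j with
  | zero => simp [hagB, poch]
  | succ j =>
    simp only [hagB]
    rw [poch_succ (x + ((j+1:ℕ):ℝ) + 2), poch_succ' (x - 1 + ((j+1:ℕ):ℝ) + 2), Nat.factorial_succ (j+1)]
    have e1 : x - 1 + ((j+1:ℕ):ℝ) + 2 + 1 = x + ((j+1:ℕ):ℝ) + 2 := by ring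
    have e2 : x + 1 + (j:ℝ) + 2 = x + ((j+1:ℕ):ℝ) + 2 := by push_cast; ring
    rw [e1, e2]
    have : ((j+1).factorial : ℝ) ≠ 0 := by positivity
    push_cast
    field_simp
    ring

lemma poch_poly (c : ℝ) (j : ℕ) : ∃ p : Polynomial ℝ, ∀ x, p.eval x = poch (x + c) j := by
  refine ⟨∏ i ∈ Finset.range j, (Polynomial.X + Polynomial.C (c + i)), fun x => ?_⟩
  simp [Polynomial.eval_prod, poch, add_assoc]

lemma hagA_poly (l : ℝ) (j : ℕ) : ∃ p : Polynomial ℝ, ∀ x, p.eval x = hagA j (l + x) := by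
  obtain ⟨p, hp⟩ := poch_poly (l + j + 1) j
  refine ⟨Polynomial.C ((j.factorial : ℝ)⁻¹) * p, fun x => ?_⟩
  simp only [Polynomial.eval_mul, Polynomial.eval_C, hp, hagA]
  rw [show x + (l + j + 1) = l + x + j + 1 by ring]
  ring

lemma hagB_poly (j : ℕ) : ∃ p : Polynomial ℝ, ∀ x, p.eval x = hagB j x := by
  cases j with
  | zero => exact ⟨1, fun x => by simp [hagB]⟩
  | succ j =>
    obtain ⟨p, hp⟩ := poch_poly (j + 2) j
    refine ⟨Polynomial.C (((j+1).factorial : ℝ)⁻¹) * (Polynomial.X * p), fun x => ?_⟩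
    simp only [Polynomial.eval_mul, Polynomial.eval_C, Polynomial.eval_X, hp, hagB]
    rw [show x + (j + 2) = x + (j:ℝ) + 2 by ring]
    ring

lemma rothe_hagen (n : ℕ) : ∀ l m : ℝ,
    ∑ p ∈ Finset.HasAntidiagonal.antidiagonal n, hagA p.1 l * hagB p.2 m = hagA n (l + m) := by
  induction n with
  | zero => intro l m; simp [hagA_zero, hagB_zero]
  | succ n ih =>
    intro l
    have step : ∀ m : ℝ, (∑ p ∈ Finset.HasAntidiagonal.antidiagonal (n+1), hagA p.1 l * hagB p.2 m) - hagA (n+1) (l + m)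
        = (∑ p ∈ Finset.HasAntidiagonal.antidiagonal (n+1), hagA p.1 l * hagB p.2 (m-1)) - hagA (n+1) (l + (m-1)) := by
      intro m
      rw [Finset.Nat.sum_antidiagonal_succ', Finset.Nat.sum_antidiagonal_succ', hagA_pascal n (l+m)]
      simp only [hagB_pascal _ m, hagB_zero, mul_add, Finset.sum_add_distrib, ih]
      rw [show l + m - 1 = l + (m-1) by ring, show l + m + 1 = l + (m+1) by ring]
      ring
    have hnat : ∀ k : ℕ, ∑ p ∈ Finset.HasAntidiagonal.antidiagonal (n+1), hagA p.1 l * hagB p.2 (k:ℝ) = hagA (n+1) (l + k) := by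
      intro k
      induction k with
      | zero =>
        rw [Finset.Nat.sum_antidiagonal_succ']
        simp [hagB_at_zero, hagB_zero]
      | succ k ihk =>
        have := step ((k+1 : ℕ):ℝ)
        rw [show ((k+1 : ℕ):ℝ) - 1 = k by push_cast; ring, ihk] at this
        linarith
    choose pB hpB using hagB_poly
    obtain ⟨q, hq⟩ := hagA_poly l (n+1)
    have := Polynomial.eq_of_infinite_eval_eq
      (∑ p ∈ Finset.HasAntidiagonal.antidiagonal (n+1), Polynomial.C (hagA p.1 l) * pB p.2) q (by
        apply Set.Infinite.mono _ (Set.infinite_range_of_injective (Nat.cast_injective (R := ℝ)))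
        rintro _ ⟨k, rfl⟩
        simp only [Set.mem_ofPred_eq, Polynomial.eval_finsetSum, Polynomial.eval_mul, Polynomial.eval_C, hpB, hq]
        exact hnat k)
    intro m
    rw [← hq, ← this]
    simp [Polynomial.eval_finsetSum, hpB]

/-- Gegenbauer moment recursion. -/
def GegMom (m : ℕ → ℝ) (l : ℝ) : Prop :=
  m 1 = 0 ∧ ∀ n : ℕ, m (n+2) * (n + 2 * l + 2) = (n + 1) * m n

lemma GegMom.odd {m : ℕ → ℝ} {l : ℝ} (h : GegMom m l) (hl : -1 < l) (j : ℕ) : m (2*j+1) = 0 := by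
  induction j with
  | zero => exact h.1
  | succ j ih =>
    have := h.2 (2*j+1)
    rw [ih] at this
    push_cast at this
    have h2 : (2 * (j:ℝ) + 1 + 2 * l + 2) ≠ 0 := by
      have : (0:ℝ) ≤ j := by positivity
      intro h; linarith
    have t : m (2*j+1+2) = 0 := by simpa [h2] using this
    exact t

lemma GegMom.unique {m m' : ℕ → ℝ} {l : ℝ} (h : GegMom m l) (h' : GegMom m' l) (hl : -1 < l)
    (h0 : m' 0 ≠ 0) (n : ℕ) : m n = m 0 / m' 0 * m' n := by
  induction n using Nat.twoStepInduction with
  | zero => field_simp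
  | one => rw [h.1, h'.1]; simp
  | more n ih _ =>
    have a := h.2 n
    have b := h'.2 n
    have h2 : ((n:ℝ) + 2 * l + 2) ≠ 0 := by
      have : (0:ℝ) ≤ n := by positivity
      intro h; linarith
    apply mul_right_cancel₀ h2
    rw [a, mul_assoc, b, ih]; ring

lemma GegMom.evenA {m : ℕ → ℝ} {l : ℝ} (h : GegMom m l) (hl : -1 < l) (j : ℕ) :
    poch (l+1) (2*j) / ((2*j).factorial : ℝ) * m (2*j) = m 0 * (hagA j l / 4^j) := by
  induction j with
  | zero => simp [poch_zero', hagA_zero]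
  | succ j ih =>
    have hj : (0:ℝ) ≤ j := by positivity
    have r1 : hagA (j+1) l * ((l + j + 1) * (j+1)) = (l+2*j+1)*(l+2*j+2) * hagA j l := by
      unfold hagA
      have e := poch_succ' (l + j + 1) (j+1)
      rw [poch_succ, poch_succ] at e
      rw [show l + ((j+1:ℕ):ℝ) + 1 = l + j + 1 + 1 by push_cast; ring, Nat.factorial_succ]
      push_cast at e ⊢
      have : (j.factorial : ℝ) ≠ 0 := by positivity
      field_simp
      linear_combination -e
    have r2 := h.2 (2*j)
    have h2 : ((2*(j:ℝ)) + 2 * l + 2) ≠ 0 := by intro h; linarith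
    have h3 : (l + j + 1) ≠ 0 := by intro h; linarith
    push_cast at r2
    rw [show 2*(j+1) = 2*j+1+1 by ring, poch_succ, poch_succ, Nat.factorial_succ, Nat.factorial_succ,
      show 2*j+1+1 = 2*j+2 by ring]
    have e1 : m (2*j+2) = (2 * j + 1) * m (2*j) / (2*(j:ℝ) + 2 * l + 2) := by
      rw [eq_div_iff h2, r2]
    have e2 : hagA (j+1) l = (l+2*j+1)*(l+2*j+2) * hagA j l / ((l + j + 1) * (j+1)) := by
      rw [eq_div_iff (by positivity), r1]
    rw [e1, e2]
    have : ((2*j).factorial : ℝ) ≠ 0 := by positivity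
    have e3 : hagA j l = poch (l+1) (2*j) / ((2*j).factorial : ℝ) * m (2*j) * 4^j / m 0 ∨ m 0 = 0 := by
      by_cases h0 : m 0 = 0
      · right; exact h0
      · left; rw [ih]; field_simp
    push_cast
    have e4 : 2*(j:ℝ) + 2 * l + 2 = 2 * (l + j + 1) := by ring
    rw [e4]
    calc _ = (poch (l+1) (2*j) / ((2*j).factorial : ℝ) * m (2*j)) * ((l+2*j+1)*(l+2*j+2) / (4 * ((l + j + 1) * (j+1)))) := by
          field_simp
          ring
      _ = _ := by
          rw [ih, pow_succ]; field_simp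

lemma GegMom.evenB {m : ℕ → ℝ} {l : ℝ} (h : GegMom m l) (hl : -1 < l) (j : ℕ) :
    poch l (2*j) / ((2*j).factorial : ℝ) * m (2*j) = m 0 * (hagB j l / 4^j) := by
  induction j with
  | zero => simp [poch_zero', hagB_zero]
  | succ j ih =>
    have hj : (0:ℝ) ≤ j := by positivity
    have r1 : hagB (j+1) l * ((l + j + 1) * (j+1)) = (l+2*j)*(l+2*j+1) * hagB j l := by
      cases j with
      | zero => simp [hagB, poch]
      | succ j =>
        simp only [hagB]
        have e := poch_succ' (l + j + 2) (j+1)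
        rw [poch_succ, poch_succ] at e
        rw [show l + ((j+1:ℕ):ℝ) + 2 = l + j + 2 + 1 by push_cast; ring, Nat.factorial_succ (j+1), poch_succ]
        rw [poch_succ] at e
        push_cast at e ⊢
        have : ((j+1).factorial : ℝ) ≠ 0 := by positivity
        field_simp
        linear_combination -(l) *e
    have r2 := h.2 (2*j)
    have h2 : ((2*(j:ℝ)) + 2 * l + 2) ≠ 0 := by intro h; linarith
    have h3 : (l + j + 1) ≠ 0 := by intro h; linarith
    push_cast at r2
    rw [show 2*(j+1) = 2*j+1+1 by ring, poch_succ, poch_succ, Nat.factorial_succ, Nat.factorial_succ,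
      show 2*j+1+1 = 2*j+2 by ring]
    have e1 : m (2*j+2) = (2 * j + 1) * m (2*j) / (2*(j:ℝ) + 2 * l + 2) := by
      rw [eq_div_iff h2, r2]
    have e2 : hagB (j+1) l = (l+2*j)*(l+2*j+1) * hagB j l / ((l + j + 1) * (j+1)) := by
      rw [eq_div_iff (by positivity), r1]
    rw [e1, e2]
    have : ((2*j).factorial : ℝ) ≠ 0 := by positivity
    push_cast
    have e4 : 2*(j:ℝ) + 2 * l + 2 = 2 * (l + j + 1) := by ring
    rw [e4]
    calc _ = (poch l (2*j) / ((2*j).factorial : ℝ) * m (2*j)) * ((l+2*j)*(l+2*j+1) / (4 * ((l + j + 1) * (j+1)))) := by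
          field_simp
          ring
      _ = _ := by
          rw [ih, pow_succ]; field_simp

lemma sum_antidiagonal_even (N : ℕ) (f : ℕ → ℕ → ℝ) (hf : ∀ j l, f (2*j+1) l = 0) :
    ∑ p ∈ Finset.HasAntidiagonal.antidiagonal (2*N), f p.1 p.2 = ∑ p ∈ Finset.HasAntidiagonal.antidiagonal N, f (2*p.1) (2*p.2) := by
  symm
  apply Finset.sum_of_injOn (fun p : ℕ × ℕ => (2*p.1, 2*p.2))
  · rintro ⟨a, b⟩ _ ⟨c, d⟩ _ h
    simp at h ⊢; exact h
  · rintro ⟨a, b⟩ h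
    simp at h ⊢; omega
  · rintro ⟨a, b⟩ h h'
    rcases Nat.even_or_odd' a with ⟨c, rfl | rfl⟩
    · exfalso; apply h'
      simp at h
      refine ⟨(c, N - c), ?_, ?_⟩
      · simp; omega
      · simp; omega
    · exact hf _ _
  · intros; rfl

lemma conv_moment {S Z Q : ℕ → ℝ} {l m : ℝ} (hS : GegMom S l) (hZ : GegMom Z m)
    (hQ : GegMom Q (l+m)) (hl : -1 < l) (hm : -1 < m) (hlm : -1 < l + m) (hQ0 : Q 0 ≠ 0) (n : ℕ) :
    ∑ p ∈ Finset.HasAntidiagonal.antidiagonal n, (n.choose p.1 : ℝ) * (poch (l+1) p.1 * poch m p.2) * (S p.1 * Z p.2)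
      = S 0 * Z 0 / Q 0 * poch (l+m+1) n * Q n := by
  rcases Nat.even_or_odd' n with ⟨N, rfl | rfl⟩
  · rw [sum_antidiagonal_even N
      (fun a b => ((2*N).choose a : ℝ) * (poch (l+1) a * poch m b) * (S a * Z b))]
    · have hq := hQ.evenA hlm N
      rw [← rothe_hagen] at hq
      have hN : ((2*N).factorial : ℝ) ≠ 0 := by positivity
      have : poch (l+m+1) (2*N) * Q (2*N) = (2*N).factorial * (Q 0 * ((∑ p ∈ Finset.HasAntidiagonal.antidiagonal N, hagA p.1 l * hagB p.2 m) / 4^N)) := by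
        rw [← hq]; field_simp
      rw [mul_assoc, this]
      have h2 : S 0 * Z 0 / Q 0 * (((2*N).factorial:ℝ) * (Q 0 * ((∑ p ∈ Finset.HasAntidiagonal.antidiagonal N, hagA p.1 l * hagB p.2 m) / 4^N)))
        = ∑ p ∈ Finset.HasAntidiagonal.antidiagonal N, ((2*N).factorial:ℝ) * (S 0 * Z 0) / 4^N * (hagA p.1 l * hagB p.2 m) := by
        rw [← Finset.mul_sum]; field_simp
      rw [h2]
      apply Finset.sum_congr rfl
      rintro ⟨a, b⟩ hab
      rw [Finset.HasAntidiagonal.mem_antidiagonal] at hab; simp only at hab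
      subst hab
      have ha := hS.evenA hl a
      have hb := hZ.evenB hm b
      simp only
      have hc : ((2*(a+b)).choose (2*a) : ℝ) = (2*(a+b)).factorial / ((2*a).factorial * (2*b).factorial) := by
        rw [Nat.cast_choose ℝ (by omega)]
        congr 4; omega
      rw [hc]
      calc _ = ((2*(a+b)).factorial : ℝ) * ((poch (l+1) (2*a) / ((2*a).factorial : ℝ) * S (2*a)) * (poch m (2*b) / ((2*b).factorial : ℝ) * Z (2*b))) := by
            field_simp
        _ = _ := by rw [ha, hb, pow_add]; field_simp
    · intro j _; simp [hS.odd hl]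
  · rw [hQ.odd hlm, mul_zero]
    apply Finset.sum_eq_zero
    rintro ⟨a, b⟩ hab
    rw [Finset.HasAntidiagonal.mem_antidiagonal] at hab; simp only at hab
    rcases Nat.even_or_odd' a with ⟨c, rfl | rfl⟩
    · have : b = 2 * (N - c) + 1 := by omega
      simp only
      rw [this, hZ.odd hm]; simp
    · simp [hS.odd hl]

lemma meas_ext_of_moments (P Q : Measure ℝ) [IsFiniteMeasure P] [IsFiniteMeasure Q]
    (hP : ∀ᵐ x ∂P, x ∈ Icc (-1:ℝ) 1) (hQ : ∀ᵐ x ∂Q, x ∈ Icc (-1:ℝ) 1)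
    (h : ∀ n : ℕ, ∫ x, x^n ∂P = ∫ x, x^n ∂Q) : P = Q := by
  have key : ∀ (P : Measure ℝ) [IsFiniteMeasure P], (∀ᵐ x ∂P, x ∈ Icc (-1:ℝ) 1) →
      ∀ f : ℝ → ℝ, Continuous f → Integrable f P := by
    intro P _ hP f hf
    obtain ⟨C, hC⟩ := (isCompact_Icc (a := (-1:ℝ)) (b := 1)).exists_bound_of_continuousOn hf.continuousOn
    refine Integrable.of_bound hf.aestronglyMeasurable C ?_
    filter_upwards [hP] with x hx using hC x hx
  have hpoly : ∀ p : Polynomial ℝ, ∫ x, p.eval x ∂P = ∫ x, p.eval x ∂Q := by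
    intro p
    simp only [Polynomial.eval_eq_sum_range]
    rw [integral_finsetSum _ (fun i _ => key P hP _ (by fun_prop)),
      integral_finsetSum _ (fun i _ => key Q hQ _ (by fun_prop))]
    simp only [integral_const_mul, h]
  apply ext_of_forall_integral_eq_of_IsFiniteMeasure
  intro f
  have bd : ∀ (P : Measure ℝ) [IsFiniteMeasure P], (∀ᵐ x ∂P, x ∈ Icc (-1:ℝ) 1) →
      ∀ (p : Polynomial ℝ) (ε : ℝ), (∀ x ∈ Set.Icc (-1:ℝ) 1, |p.eval x - f x| < ε) →
      |∫ x, p.eval x ∂P - ∫ x, f x ∂P| ≤ ε * P.real univ := by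
    intro P _ hP p ε hp
    rw [← integral_sub (key P hP _ p.continuous) (key P hP _ f.continuous), ← Real.norm_eq_abs]
    apply norm_integral_le_of_norm_le_const
    filter_upwards [hP] with x hx using (hp x hx).le
  apply eq_of_abs_sub_le_all
  intro ε hε
  have hM : 0 ≤ P.real univ := measureReal_nonneg
  have hM' : 0 ≤ Q.real univ := measureReal_nonneg
  obtain ⟨p, hp⟩ := exists_polynomial_near_of_continuousOn (-1) 1 f f.continuous.continuousOn
    (ε / (P.real univ + Q.real univ + 1)) (by positivity)
  have b1 := bd P hP p _ hp
  have b2 := bd Q hQ p _ hp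
  rw [hpoly p] at b1
  have : ε / (P.real univ + Q.real univ + 1) * P.real univ + ε / (P.real univ + Q.real univ + 1) * Q.real univ ≤ ε := by
    rw [← mul_add, div_mul_eq_mul_div, div_le_iff₀ (by positivity)]
    nlinarith
  rw [abs_le] at *
  constructor <;> linarith [b1.1, b1.2, b2.1, b2.2]

noncomputable def jw (a b z : ℝ) : ℝ := (1 - z) ^ a * (1 + z) ^ b

noncomputable def jJ (a b : ℝ) : ℝ := ∫ z in (-1:ℝ)..1, jw a b z

lemma jw_int_half {a b : ℝ} (hb : -1 < b) : IntervalIntegrable (jw a b) volume (-1) 0 := by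
  have h : IntervalIntegrable (fun z : ℝ => (1 + z) ^ b) volume (-1) 0 := by
    have := (intervalIntegral.intervalIntegrable_rpow' hb (a := 0) (b := 1)).comp_add_left 1
    simpa using this
  unfold jw
  apply h.continuousOn_mul
  intro z hz
  rw [uIcc_of_le (by norm_num)] at hz
  apply ContinuousAt.continuousWithinAt
  apply ContinuousAt.rpow_const (by fun_prop)
  left; linarith [hz.2]

lemma jw_int {a b : ℝ} (ha : -1 < a) (hb : -1 < b) : IntervalIntegrable (jw a b) volume (-1) 1 := by
  refine (jw_int_half hb).trans ?_
  have := ((IntervalIntegrable.iff_comp_neg (by simp)).1 (jw_int_half (a := b) (b := a) ha)).symm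
  simp only [neg_zero, neg_neg] at this
  refine this.congr (fun z _ => ?_)
  simp only [jw]
  ring_nf

lemma jw_nonneg {a b z : ℝ} (hz : z ∈ Icc (-1:ℝ) 1) : 0 ≤ jw a b z :=
  mul_nonneg (rpow_nonneg (by linarith [hz.2]) _) (rpow_nonneg (by linarith [hz.1]) _)

lemma jw_succ_left {a b z : ℝ} (ha : -1 < a) (hz : z ∈ Icc (-1:ℝ) 1) :
    jw (a+1) b z = (1 - z) * jw a b z := by
  unfold jw
  rw [rpow_add_one' (by linarith [hz.2]) (by linarith)]; ring

lemma jw_succ_right {a b z : ℝ} (hb : -1 < b) (hz : z ∈ Icc (-1:ℝ) 1) :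
    jw a (b+1) z = (1 + z) * jw a b z := by
  unfold jw
  rw [rpow_add_one' (by linarith [hz.1]) (by linarith)]; ring

lemma jw_hasDeriv {a b z : ℝ} (hz : z ∈ Ioo (-1:ℝ) 1) :
    HasDerivAt (jw (a+1) (b+1)) (-(a+1) * jw a (b+1) z + (b+1) * jw (a+1) b z) z := by
  unfold jw
  have h1 : HasDerivAt (fun z : ℝ => (1 - z)^(a+1)) (-1 * (a+1) * (1-z)^(a+1-1)) z := by
    apply HasDerivAt.rpow_const
    · simpa using (hasDerivAt_id z).const_sub 1
    · left; linarith [hz.2]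
  have h2 : HasDerivAt (fun z : ℝ => (1 + z)^(b+1)) (1 * (b+1) * (1+z)^(b+1-1)) z := by
    apply HasDerivAt.rpow_const
    · simpa using (hasDerivAt_id z).const_add 1
    · left; linarith [hz.1]
  refine (h1.mul h2).congr_deriv ?_
  simp only [add_sub_cancel_right]
  ring

lemma jw_cont {a b : ℝ} (ha : 0 ≤ a) (hb : 0 ≤ b) : Continuous (jw a b) := by
  unfold jw
  exact (Continuous.rpow_const (by fun_prop) (fun _ => Or.inr ha)).mul
    (Continuous.rpow_const (by fun_prop) (fun _ => Or.inr hb))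

lemma uIcc11 : uIcc (-1:ℝ) 1 = Icc (-1) 1 := uIcc_of_le (by norm_num)

lemma jJ_rel1 {a b : ℝ} (ha : -1 < a) (hb : -1 < b) : (b+1) * jJ (a+1) b = (a+1) * jJ a (b+1) := by
  have h := intervalIntegral.integral_eq_sub_of_hasDerivAt_of_le (a := -1) (b := 1) (by norm_num)
    (jw_cont (a := a+1) (b := b+1) (by linarith) (by linarith)).continuousOn
    (fun z hz => jw_hasDeriv (a := a) (b := b) hz)
    (((jw_int ha (by linarith : -1 < b+1)).const_mul _).add
      ((jw_int (by linarith : -1 < a+1) hb).const_mul _))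
  rw [intervalIntegral.integral_add ((jw_int ha (by linarith : -1 < b+1)).const_mul _)
      ((jw_int (by linarith : -1 < a+1) hb).const_mul _), intervalIntegral.integral_const_mul,
      intervalIntegral.integral_const_mul] at h
  have e : jw (a+1) (b+1) 1 - jw (a+1) (b+1) (-1) = 0 := by
    simp [jw, zero_rpow (by linarith : a + 1 ≠ 0), zero_rpow (by linarith : b + 1 ≠ 0)]
  rw [e] at h
  unfold jJ
  linarith

lemma jJ_rel2 {a b : ℝ} (ha : -1 < a) (hb : -1 < b) : jJ (a+1) b + jJ a (b+1) = 2 * jJ a b := by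
  unfold jJ
  rw [← intervalIntegral.integral_add (jw_int (by linarith) hb) (jw_int ha (by linarith)),
    ← intervalIntegral.integral_const_mul]
  apply intervalIntegral.integral_congr
  intro z hz
  rw [uIcc11] at hz
  simp only [jw_succ_left ha hz, jw_succ_right hb hz]
  ring

lemma jJ_left {a b : ℝ} (ha : -1 < a) (hb : -1 < b) : jJ (a+1) b = 2 * (a+1)/(a+b+2) * jJ a b := by
  have h1 := jJ_rel1 ha hb
  have h2 := jJ_rel2 ha hb
  rw [div_mul_eq_mul_div, eq_div_iff (by linarith)]
  linear_combination h1 + (a+1) * h2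

lemma jJ_right {a b : ℝ} (ha : -1 < a) (hb : -1 < b) : jJ a (b+1) = 2 * (b+1)/(a+b+2) * jJ a b := by
  have h1 := jJ_rel1 ha hb
  have h2 := jJ_rel2 ha hb
  rw [div_mul_eq_mul_div, eq_div_iff (by linarith)]
  linear_combination -h1 + (b+1) * h2

lemma jJ_kl {a b : ℝ} (ha : -1 < a) (hb : -1 < b) (k l : ℕ) :
    jJ (a+k) (b+l) = 2^(k+l) * (poch (a+1) k * poch (b+1) l / poch (a+b+2) (k+l)) * jJ a b := by
  induction l with
  | zero =>
    induction k with
    | zero => simp [poch]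
    | succ k ih =>
      have hk : (0:ℝ) ≤ k := by positivity
      have hp := poch_pos' (by linarith : 0 < a+b+2) k
      simp only [add_zero, Nat.cast_zero] at ih ⊢
      rw [show a + ((k+1:ℕ):ℝ) = a + k + 1 by push_cast; ring, jJ_left (by linarith) hb, ih]
      simp only [poch_succ]
      have : a + b + 2 + k ≠ 0 := by linarith
      have : a + k + b + 2 ≠ 0 := by linarith
      field_simp
      ring
  | succ l ih =>
    have hk : (0:ℝ) ≤ k := by positivity
    have hl : (0:ℝ) ≤ l := by positivity
    have hp := poch_pos' (by linarith : 0 < a+b+2) (k+l)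
    rw [show b + ((l+1:ℕ):ℝ) = b + l + 1 by push_cast; ring, jJ_right (by linarith) (by linarith), ih,
      show k + (l+1) = (k+l)+1 from rfl]
    simp only [poch_succ]
    push_cast
    have : a + b + 2 + (k + l) ≠ 0 := by linarith
    have : a + k + (b + l) + 2 ≠ 0 := by linarith
    field_simp
    ring

lemma jJ_pos {a b : ℝ} (ha : -1 < a) (hb : -1 < b) : 0 < jJ a b := by
  apply intervalIntegral.intervalIntegral_pos_of_pos_on (jw_int ha hb) _ (by norm_num)
  intro z hz
  exact mul_pos (rpow_pos_of_pos (by linarith [hz.2]) _) (rpow_pos_of_pos (by linarith [hz.1]) _)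

lemma jw_kl {a b z : ℝ} (ha : -1 < a) (hb : -1 < b) (hz : z ∈ Icc (-1:ℝ) 1) (k l : ℕ) :
    jw (a+k) (b+l) z = (1-z)^k * (1+z)^l * jw a b z := by
  induction l with
  | zero =>
    induction k with
    | zero => simp
    | succ k ih =>
      have hk : (0:ℝ) ≤ k := by positivity
      simp only [add_zero, Nat.cast_zero] at ih ⊢
      rw [show a + ((k+1:ℕ):ℝ) = a + k + 1 by push_cast; ring, jw_succ_left (by linarith) hz, ih]
      ring
  | succ l ih =>
    have hl : (0:ℝ) ≤ l := by positivity
    rw [show b + ((l+1:ℕ):ℝ) = b + l + 1 by push_cast; ring, jw_succ_right (by linarith) hz, ih]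
    ring

/-- Jacobi weight measure -/
noncomputable def jM (a b : ℝ) : Measure ℝ :=
  (volume.restrict (Ioc (-1:ℝ) 1)).withDensity (fun z => ENNReal.ofReal (jw a b z))

lemma jw_meas (a b : ℝ) : Measurable (jw a b) := by unfold jw; fun_prop

lemma jM_integral (a b : ℝ) (f : ℝ → ℝ) : ∫ z, f z ∂(jM a b) = ∫ z in (-1:ℝ)..1, f z * jw a b z := by
  unfold jM
  rw [integral_withDensity_eq_integral_toReal_smul (by have := jw_meas a b; fun_prop) (by simp),
    intervalIntegral.integral_of_le (by norm_num)]
  apply setIntegral_congr_fun measurableSet_Ioc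
  intro z hz
  simp only [smul_eq_mul]
  rw [ENNReal.toReal_ofReal (jw_nonneg ⟨hz.1.le, hz.2⟩), mul_comm]

lemma jM_finite {a b : ℝ} (ha : -1 < a) (hb : -1 < b) : IsFiniteMeasure (jM a b) := by
  apply isFiniteMeasure_withDensity_ofReal
  have := (intervalIntegrable_iff_integrableOn_Ioc_of_le (by norm_num)).1 (jw_int ha hb)
  exact this.2

lemma jM_supp (a b : ℝ) : ∀ᵐ x ∂(jM a b), x ∈ Icc (-1:ℝ) 1 := by
  apply (withDensity_absolutelyContinuous _ _).ae_le
  filter_upwards [ae_restrict_mem measurableSet_Ioc] with x hx using ⟨hx.1.le, hx.2⟩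

lemma jM_kl {a b : ℝ} (ha : -1 < a) (hb : -1 < b) (k l : ℕ) :
    ∫ z, ((1-z)/2)^k * ((1+z)/2)^l ∂(jM a b) =
      poch (a+1) k * poch (b+1) l / poch (a+b+2) (k+l) * jJ a b := by
  rw [jM_integral]
  have : jJ (a+k) (b+l) = ∫ z in (-1:ℝ)..1, 2^(k+l) * ((((1-z)/2)^k * ((1+z)/2)^l) * jw a b z) := by
    apply intervalIntegral.integral_congr
    intro z hz
    rw [uIcc11] at hz
    simp only [jw_kl ha hb hz, div_pow, pow_add]
    field_simp
  rw [jJ_kl ha hb, intervalIntegral.integral_const_mul, mul_assoc] at this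
  exact (mul_left_cancel₀ (by positivity) this).symm

lemma jM_geg {ν : ℝ} (hν : -1 < ν) : GegMom (fun n => ∫ v, v^n ∂(jM ν ν)) (ν + 1/2) := by
  have int : ∀ n : ℕ, IntervalIntegrable (fun v : ℝ => v^n * jw ν ν v) volume (-1) 1 := fun n =>
    (jw_int hν hν).continuousOn_mul (by fun_prop)
  simp only [jM_integral]
  constructor
  · have h := intervalIntegral.integral_comp_neg (a := -1) (b := 1) (fun v : ℝ => v^1 * jw ν ν v)
    simp only [neg_neg] at h
    have e : ∀ v : ℝ, (-v)^1 * jw ν ν (-v) = -(v^1 * jw ν ν v) := by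
      intro v; simp only [jw, sub_neg_eq_add]; rw [← sub_eq_add_neg]; ring
    simp only [e, intervalIntegral.integral_neg] at h
    linarith
  · intro n
    have hd : ∀ z ∈ Ioo (-1:ℝ) 1, HasDerivAt (fun v : ℝ => v^(n+1) * jw (ν+1) (ν+1) v)
        ((n+1) * (z^n * jw ν ν z) - (n + 2 * (ν+1/2) + 2) * (z^(n+2) * jw ν ν z)) z := by
      intro z hz
      have hz' : z ∈ Icc (-1:ℝ) 1 := ⟨hz.1.le, hz.2.le⟩
      refine ((hasDerivAt_pow (n+1) z).mul (jw_hasDeriv (a := ν) (b := ν) hz)).congr_deriv ?_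
      rw [jw_succ_left hν hz', jw_succ_left hν hz', jw_succ_right hν hz']
      simp only [Nat.add_sub_cancel]
      push_cast
      ring
    have h := intervalIntegral.integral_eq_sub_of_hasDerivAt_of_le (a := -1) (b := 1) (by norm_num)
      (((continuous_pow (n+1)).mul (jw_cont (a := ν+1) (b := ν+1) (by linarith) (by linarith))).continuousOn)
      hd (((int n).const_mul _).sub ((int (n+2)).const_mul _))
    rw [intervalIntegral.integral_sub ((int n).const_mul _) ((int (n+2)).const_mul _),
      intervalIntegral.integral_const_mul, intervalIntegral.integral_const_mul] at h
    have e0 : jw (ν+1) (ν+1) 1 = 0 := by simp [jw, zero_rpow (by linarith : ν + 1 ≠ 0)]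
    have e1 : jw (ν+1) (ν+1) (-1) = 0 := by simp [jw, zero_rpow (by linarith : ν + 1 ≠ 0)]
    simp only [Pi.mul_apply, e0, e1] at h
    linarith

lemma jM_zero_pos {a b : ℝ} (ha : -1 < a) (hb : -1 < b) : 0 < ∫ v, v^0 ∂(jM a b) := by
  rw [jM_integral]
  simpa [jJ] using jJ_pos ha hb

noncomputable def sphMom (d : ℕ) (ξ : Euc d) (n : ℕ) : ℝ := ∫ η, ⟪ξ, (η : Euc d)⟫ ^ n ∂(sphMeas d)

noncomputable def radMom (d n : ℕ) : ℝ := ∫ r in Ioi (0:ℝ), r ^ ((d:ℝ) - 1 + n) * exp (- r ^ (2:ℝ))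

lemma radMom_eq {d : ℕ} (hd : 2 ≤ d) (n : ℕ) : radMom d n = 1/2 * Real.Gamma (((d:ℝ) + n)/2) := by
  have : (2:ℝ) ≤ d := by exact_mod_cast hd
  have hn : (0:ℝ) ≤ n := by positivity
  unfold radMom
  rw [integral_rpow_mul_exp_neg_rpow (by norm_num) (by linarith)]
  congr 2; ring

lemma radMom_pos {d : ℕ} (hd : 2 ≤ d) (n : ℕ) : 0 < radMom d n := by
  rw [radMom_eq hd]
  have : (2:ℝ) ≤ d := by exact_mod_cast hd
  have := Real.Gamma_pos_of_pos (s := ((d:ℝ) + n)/2) (by positivity)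
  positivity

lemma radMom_succ {d : ℕ} (hd : 2 ≤ d) (n : ℕ) : radMom d (n+2) = ((d:ℝ)+n)/2 * radMom d n := by
  rw [radMom_eq hd, radMom_eq hd]
  have : (2:ℝ) ≤ d := by exact_mod_cast hd
  rw [show ((d:ℝ) + ((n+2:ℕ):ℝ))/2 = ((d:ℝ) + n)/2 + 1 by push_cast; ring, Real.Gamma_add_one (by positivity)]
  ring

noncomputable def gauF (d : ℕ) (ξ : Euc d) (n : ℕ) (x : Euc d) : ℝ := ⟪ξ, x⟫ ^ n * exp (-‖x‖^2)

lemma gau_polar {d : ℕ} (hd : 2 ≤ d) (ξ : Euc d) (n : ℕ) :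
    ∫ x, gauF d ξ n x = sphMom d ξ n * radMom d n := by
  have : Nontrivial (Euc d) := by
    have : Nonempty (Fin d) := ⟨⟨0, by omega⟩⟩
    infer_instance
  have hmp := (volume : Measure (Euc d)).measurePreserving_homeomorphUnitSphereProd
  have hdim : Module.finrank ℝ (Euc d) = d := by simp
  calc ∫ x, gauF d ξ n x = ∫ x : ({(0)}ᶜ : Set (Euc d)), gauF d ξ n x.1 ∂((volume : Measure (Euc d)).comap (↑)) := by
        rw [integral_subtype_comap (measurableSet_singleton _).compl (gauF d ξ n),
          restrict_compl_singleton]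
    _ = ∫ p, (⟪ξ, (p.1 : Euc d)⟫ ^ n) * ((p.2:ℝ)^n * exp (-(p.2:ℝ)^2)) ∂((volume : Measure (Euc d)).toSphere.prod (.volumeIoiPow (Module.finrank ℝ (Euc d) - 1))) := by
        rw [← hmp.integral_comp (Homeomorph.measurableEmbedding _)]
        congr 1
        ext x
        have hx : ‖x.1‖ ≠ 0 := norm_ne_zero_iff.2 (by exact x.2)
        simp only [gauF, homeomorphUnitSphereProd_apply_snd_coe, homeomorphUnitSphereProd_apply_fst_coe, inner_smul_right, mul_pow, inv_pow]
        field_simp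
    _ = sphMom d ξ n * ∫ x : Ioi (0 : ℝ), ((x:ℝ)^n * exp (-(x:ℝ)^2)) ∂.volumeIoiPow (Module.finrank ℝ (Euc d) - 1) := by
        exact integral_prod_mul (fun η : Metric.sphere (0 : Euc d) 1 => ⟪ξ, (η : Euc d)⟫ ^ n)
          (fun x : Ioi (0:ℝ) => ((x:ℝ)^n * exp (-(x:ℝ)^2)))
    _ = sphMom d ξ n * radMom d n := by
      congr 1
      simp only [Measure.volumeIoiPow, ENNReal.ofReal, hdim]
      rw [integral_withDensity_eq_integral_smul,
        integral_subtype_comap measurableSet_Ioi fun a ↦ Real.toNNReal (a ^ (d - 1)) • (a^n * exp (-a^2)), radMom]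
      · apply setIntegral_congr_fun measurableSet_Ioi
        intro x hx
        have hx : 0 < x := hx
        simp only
        rw [NNReal.smul_def, Real.coe_toNNReal _ (pow_nonneg hx.le _), smul_eq_mul,
          rpow_add hx, rpow_natCast, ← mul_assoc, rpow_two]
        rw [show (d:ℝ) - 1 = ((d-1 : ℕ):ℝ) by rw [Nat.cast_sub (by omega)]; simp, rpow_natCast]
      · exact (measurable_subtype_coe.pow_const _).real_toNNReal

lemma gau_int {d : ℕ} (hd : 2 ≤ d) (ξ : Euc d) (n : ℕ) : Integrable (gauF d ξ n) := by
  have : Nontrivial (Euc d) := by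
    have : Nonempty (Fin d) := ⟨⟨0, by omega⟩⟩
    infer_instance
  have h1 : Integrable (fun x : Euc d => ‖x‖^n * exp (-‖x‖^2)) := by
    refine (integrable_fun_norm_addHaar (volume : Measure (Euc d)) (f := fun r => r^n * exp (-r^2))).2 ?_
    have h2 : (2:ℝ) ≤ d := by exact_mod_cast hd
    have hn : (0:ℝ) ≤ n := by positivity
    have := integrableOn_rpow_mul_exp_neg_mul_sq one_pos (s := (d:ℝ) - 1 + n) (by linarith)
    refine this.congr_fun ?_ measurableSet_Ioi
    intro x hx
    have hx : 0 < x := hx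
    simp only [smul_eq_mul, finrank_euclideanSpace, Fintype.card_fin]
    rw [rpow_add hx, rpow_natCast, show (d:ℝ) - 1 = ((d-1 : ℕ):ℝ) by rw [Nat.cast_sub (by omega)]; simp, rpow_natCast]
    ring_nf
  refine (h1.const_mul (‖ξ‖^n)).mono' ?_ ?_
  · apply Continuous.aestronglyMeasurable
    unfold gauF; fun_prop
  · refine Eventually.of_forall (fun x => ?_)
    simp only [gauF, norm_mul, norm_pow, Real.norm_eq_abs, abs_exp]
    rw [← mul_assoc, ← mul_pow]
    gcongr
    exact abs_real_inner_le_norm ξ x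

lemma gau_rec {d : ℕ} (hd : 2 ≤ d) (ξ : Euc d) (hξ : ‖ξ‖ = 1) (n : ℕ) :
    2 * ∫ x, gauF d ξ (n+2) x = (n+1) * ∫ x, gauF d ξ n x := by
  have hf : ∀ x : Euc d, HasFDerivAt (fun x : Euc d => ⟪ξ, x⟫^(n+1)) (((n+1:ℕ) * ⟪ξ, x⟫^n) • innerSL ℝ ξ) x := by
    intro x
    have := ((innerSL ℝ ξ).hasFDerivAt (x := x)).pow (n+1)
    simpa using this
  have hg : ∀ x : Euc d, HasFDerivAt (fun x : Euc d => exp (-‖x‖^2)) (exp (-‖x‖^2) • (-((2:ℕ) • (innerSL ℝ x : Euc d →L[ℝ] ℝ)))) x := by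
    intro x
    have := ((hasStrictFDerivAt_norm_sq x).hasFDerivAt).neg.exp
    simpa using this
  have hi : ⟪ξ, ξ⟫ = 1 := by rw [real_inner_self_eq_norm_sq, hξ]; norm_num
  have e1 : (fun x => fderiv ℝ (fun x : Euc d => ⟪ξ, x⟫^(n+1)) x ξ * exp (-‖x‖^2)) = fun x => (n+1) * gauF d ξ n x := by
    ext x
    rw [(hf x).fderiv]
    simp [gauF, -inner_self_eq_norm_sq_to_K, hi]
    try ring
  have e2 : (fun x => ⟪ξ, x⟫^(n+1) * fderiv ℝ (fun x : Euc d => exp (-‖x‖^2)) x ξ) = fun x => (-2) * gauF d ξ (n+2) x := by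
    ext x
    rw [(hg x).fderiv]
    simp [gauF, real_inner_comm]
    ring
  have h := integral_mul_fderiv_eq_neg_fderiv_mul_of_integrable (μ := (volume : Measure (Euc d)))
    (f := fun x : Euc d => ⟪ξ, x⟫^(n+1)) (g := fun x : Euc d => exp (-‖x‖^2)) (v := ξ)
    (by rw [e1]; exact (gau_int hd ξ n).const_mul _) (by rw [e2]; exact (gau_int hd ξ (n+2)).const_mul _)
    (gau_int hd ξ (n+1)) (fun x _ => (hf x).differentiableAt) (fun x _ => (hg x).differentiableAt)
  rw [e1, e2, integral_const_mul, integral_const_mul] at h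
  linarith

lemma sph_geg {d : ℕ} (hd : 2 ≤ d) (ξ : Euc d) (hξ : ‖ξ‖ = 1) :
    GegMom (sphMom d ξ) (((d:ℝ) - 2)/2) := by
  constructor
  · have h1 : ∫ x, gauF d ξ 1 x = 0 := by
      have := integral_neg_eq_self (gauF d ξ 1) volume
      have e : ∀ x, gauF d ξ 1 (-x) = - gauF d ξ 1 x := by intro x; simp [gauF]
      simp only [e, integral_neg] at this
      linarith
    rw [gau_polar hd] at h1
    simpa [(radMom_pos hd 1).ne'] using h1
  · intro n
    have h := gau_rec hd ξ hξ n
    rw [gau_polar hd, gau_polar hd, radMom_succ hd] at h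
    have hp := (radMom_pos hd n).ne'
    apply mul_right_cancel₀ hp
    linear_combination h

instance sph_finite (d : ℕ) : IsFiniteMeasure (sphMeas d) := by
  unfold sphMeas; infer_instance

lemma sphMom_zero (d : ℕ) (ξ : Euc d) : sphMom d ξ 0 = ωd d := by
  simp [sphMom, ωd, Measure.real]

lemma inner_mem {d : ℕ} {ξ : Euc d} (hξ : ‖ξ‖ = 1) (η : Metric.sphere (0 : Euc d) 1) :
    ⟪ξ, (η : Euc d)⟫ ∈ Icc (-1:ℝ) 1 := by
  have h := abs_real_inner_le_norm ξ (η : Euc d)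
  have : ‖(η : Euc d)‖ = 1 := by simp
  rw [hξ, this, one_mul] at h
  exact abs_le.1 h

lemma bdd_int {X : Type*} [MeasurableSpace X] (P : Measure X) [IsFiniteMeasure P] (f : X → ℝ) (hf : Measurable f)
    (C : ℝ) (h : ∀ᵐ x ∂P, |f x| ≤ C) : Integrable f P :=
  Integrable.of_bound hf.aestronglyMeasurable C h

/-- comparison measure -/
lemma smul_moment (c : ℝ) (hc : 0 ≤ c) (P : Measure ℝ) (n : ℕ) :
    ∫ v, v^n ∂(ENNReal.ofReal c • P) = c * ∫ v, v^n ∂P := by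
  rw [integral_smul_measure, ENNReal.toReal_ofReal hc, smul_eq_mul]

lemma push_one {d : ℕ} (hd : 2 ≤ d) {ξ : Euc d} (hξ : ‖ξ‖ = 1) :
    (sphMeas d).map (fun η : Metric.sphere (0 : Euc d) 1 => ⟪ξ, (η : Euc d)⟫) =
      ENNReal.ofReal (ωd d / jJ (((d:ℝ)-3)/2) (((d:ℝ)-3)/2)) • jM (((d:ℝ)-3)/2) (((d:ℝ)-3)/2) := by
  have h2 : (2:ℝ) ≤ d := by exact_mod_cast hd
  have hν : -1 < ((d:ℝ)-3)/2 := by linarith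
  set ν := ((d:ℝ)-3)/2 with hνd
  have := jM_finite hν hν
  have hJ := jJ_pos hν hν
  have hω : 0 ≤ ωd d := ENNReal.toReal_nonneg
  have hm : Measurable (fun η : Metric.sphere (0 : Euc d) 1 => ⟪ξ, (η : Euc d)⟫) := by fun_prop
  have hJ0 : ∫ v, v^0 ∂(jM ν ν) = jJ ν ν := by rw [jM_integral]; simp [jJ]
  have : IsFiniteMeasure (ENNReal.ofReal (ωd d / jJ ν ν) • jM ν ν) := Measure.smul_finite _ (by simp)
  apply meas_ext_of_moments
  · refine (ae_map_iff (p := fun x => x ∈ Icc (-1:ℝ) 1) hm.aemeasurable measurableSet_Icc).2 ?_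
    exact Eventually.of_forall (fun η => inner_mem hξ η)
  · exact Measure.ae_smul_measure (jM_supp _ _) _
  · intro n
    rw [smul_moment _ (by positivity), integral_map hm.aemeasurable (by fun_prop)]
    have hg := jM_geg hν
    rw [show ν + 1/2 = ((d:ℝ)-2)/2 by rw [hνd]; ring] at hg
    have := (sph_geg hd ξ hξ).unique hg (by linarith) (jM_zero_pos hν hν).ne' n
    simp only [sphMom_zero, hJ0] at this
    exact this

/-- The map of the convolution structure. -/
noncomputable def phi {d : ℕ} (ξ : Euc d) (p : Metric.sphere (0 : Euc d) 1 × (ℝ × ℝ)) : ℝ :=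
  (1 - p.2.1)/2 * ⟪ξ, (p.1 : Euc d)⟫ + (1 + p.2.1)/2 * p.2.2

lemma phi_meas {d : ℕ} (ξ : Euc d) : Measurable (phi ξ) := by
  unfold phi; fun_prop

lemma phi_mem {d : ℕ} {ξ : Euc d} (hξ : ‖ξ‖ = 1) (p : Metric.sphere (0 : Euc d) 1 × (ℝ × ℝ))
    (h1 : p.2.1 ∈ Icc (-1:ℝ) 1) (h2 : p.2.2 ∈ Icc (-1:ℝ) 1) : phi ξ p ∈ Icc (-1:ℝ) 1 := by
  have h := inner_mem hξ p.1
  obtain ⟨a, b⟩ := h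
  obtain ⟨c, e⟩ := h1
  obtain ⟨f, g⟩ := h2
  unfold phi
  constructor <;> nlinarith

lemma push_two {d : ℕ} (hd : 2 ≤ d) {β : ℝ} (hβ : -(1/2) < β) {ξ : Euc d} (hξ : ‖ξ‖ = 1) :
    ((sphMeas d).prod ((jM (((d:ℝ)-2)/2) (β-1/2)).prod (jM β β))).map (phi ξ) =
      ENNReal.ofReal (ωd d * jJ β β / jJ (β + ((d:ℝ)-2)/2) (β + ((d:ℝ)-2)/2) * jJ (((d:ℝ)-2)/2) (β-1/2))
        • jM (β + ((d:ℝ)-2)/2) (β + ((d:ℝ)-2)/2) := by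
  have h2 : (2:ℝ) ≤ d := by exact_mod_cast hd
  set l := ((d:ℝ)-2)/2 with hl
  have hl0 : 0 ≤ l := by rw [hl]; linarith
  set ν := β + l with hνd
  have hν : -1 < ν := by linarith
  have hβ1 : -1 < β := by linarith
  have hβ2 : -1 < β - 1/2 := by linarith
  have hl1 : -1 < l := by linarith
  have := jM_finite hν hν
  have := jM_finite hβ1 hβ1
  have := jM_finite hl1 hβ2
  have hJ := jJ_pos hν hν
  have hJb := jJ_pos hβ1 hβ1
  have hJl := jJ_pos hl1 hβ2
  have hω : 0 ≤ ωd d := ENNReal.toReal_nonneg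
  have hJ0 : ∀ a : ℝ, ∫ v, v^0 ∂(jM a a) = jJ a a := by intro a; rw [jM_integral]; simp [jJ]
  have : IsFiniteMeasure (ENNReal.ofReal (ωd d * jJ β β / jJ ν ν * jJ l (β-1/2)) • jM ν ν) := Measure.smul_finite _ (by simp)
  have hm := phi_meas ξ
  have hsupp : ∀ᵐ p ∂((sphMeas d).prod ((jM l (β-1/2)).prod (jM β β))), p.2.1 ∈ Icc (-1:ℝ) 1 ∧ p.2.2 ∈ Icc (-1:ℝ) 1 := by
    have : ∀ᵐ q ∂((jM l (β-1/2)).prod (jM β β)), q.1 ∈ Icc (-1:ℝ) 1 ∧ q.2 ∈ Icc (-1:ℝ) 1 :=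
      (Measure.quasiMeasurePreserving_fst.ae (jM_supp _ _)).and (Measure.quasiMeasurePreserving_snd.ae (jM_supp _ _))
    exact Measure.quasiMeasurePreserving_snd.ae this
  apply meas_ext_of_moments
  · refine (ae_map_iff (p := fun x => x ∈ Icc (-1:ℝ) 1) hm.aemeasurable measurableSet_Icc).2 ?_
    filter_upwards [hsupp] with p hp using phi_mem hξ p hp.1 hp.2
  · exact Measure.ae_smul_measure (jM_supp _ _) _
  · intro n
    rw [smul_moment _ (by positivity), integral_map hm.aemeasurable (by fun_prop)]
    have e : ∀ p, phi ξ p ^ n = ∑ q ∈ Finset.HasAntidiagonal.antidiagonal n, (n.choose q.1 : ℝ) *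
        (⟪ξ, (p.1 : Euc d)⟫^q.1 * ((((1-p.2.1)/2)^q.1 * ((1+p.2.1)/2)^q.2) * p.2.2^q.2)) := by
      intro p
      unfold phi
      rw [(Commute.all _ _).add_pow']
      apply Finset.sum_congr rfl
      intro q _
      rw [nsmul_eq_mul, mul_pow, mul_pow]; ring
    simp only [e]
    rw [integral_finsetSum]
    · have hgQ := jM_geg hν
      have hgZ := jM_geg hβ1
      rw [show ν + 1/2 = l + (β + 1/2) by rw [hνd]; ring] at hgQ
      have hc := conv_moment (sph_geg hd ξ hξ) hgZ hgQ hl1 (by linarith) (by linarith) (jM_zero_pos hν hν).ne' n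
      simp only [sphMom_zero, hJ0, ← hl] at hc
      have hp := poch_pos' (by linarith : 0 < l + (β+1/2) + 1) n
      calc _ = ∑ q ∈ Finset.HasAntidiagonal.antidiagonal n, jJ l (β-1/2) / poch (l + (β+1/2) + 1) n * ((n.choose q.1 : ℝ) * (poch (l+1) q.1 * poch (β+1/2) q.2) *
              (sphMom d ξ q.1 * ∫ v, v^q.2 ∂(jM β β))) := by
            apply Finset.sum_congr rfl
            intro q hq
            rw [integral_const_mul,
              integral_prod_mul (fun η : Metric.sphere (0 : Euc d) 1 => ⟪ξ, (η : Euc d)⟫ ^ q.1)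
                (fun z : ℝ × ℝ => (((1-z.1)/2)^q.1 * ((1+z.1)/2)^q.2) * z.2^q.2),
              integral_prod_mul (fun z : ℝ => ((1-z)/2)^q.1 * ((1+z)/2)^q.2) (fun z : ℝ => z^q.2),
              jM_kl hl1 hβ2, Finset.HasAntidiagonal.mem_antidiagonal.1 hq,
              show β - 1/2 + 1 = β + 1/2 by ring, show l + (β - 1/2) + 2 = l + (β+1/2) + 1 by ring, sphMom]
            ring
        _ = _ := by
            rw [← Finset.mul_sum, hc]
            generalize poch (l + (β+1/2) + 1) n = w at hp
            field_simp
    · intro q _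
      apply Integrable.const_mul
      refine bdd_int _ _ (by fun_prop) 1 ?_
      filter_upwards [hsupp] with p hp
      have h0 := abs_le.2 (inner_mem hξ p.1)
      have h1 : |(1 - p.2.1)/2| ≤ 1 := by rw [abs_le]; constructor <;> linarith [hp.1.1, hp.1.2]
      have h2 : |(1 + p.2.1)/2| ≤ 1 := by rw [abs_le]; constructor <;> linarith [hp.1.1, hp.1.2]
      have h3 := abs_le.2 hp.2
      simp only [abs_mul, abs_pow]
      have a0 := pow_le_one₀ (n := q.1) (abs_nonneg _) h0
      have a1 := pow_le_one₀ (n := q.1) (abs_nonneg _) h1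
      have a2 := pow_le_one₀ (n := q.2) (abs_nonneg _) h2
      have a3 := pow_le_one₀ (n := q.2) (abs_nonneg _) h3
      refine mul_le_one₀ a0 (by positivity) (mul_le_one₀ (mul_le_one₀ a1 (by positivity) a2) (by positivity) a3)

lemma jM_lintegral (a b : ℝ) (f : ℝ → ℝ≥0∞) (hf : Measurable f) :
    ∫⁻ z, f z ∂(jM a b) = ∫⁻ z in Ioc (-1:ℝ) 1, ENNReal.ofReal (jw a b z) * f z := by
  unfold jM
  rw [lintegral_withDensity_eq_lintegral_mul _ (by have := jw_meas a b; fun_prop) hf]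
  rfl

lemma jw_diag {ν z : ℝ} (hz : z ∈ Icc (-1:ℝ) 1) : jw ν ν z = (1 - z^2)^ν := by
  unfold jw
  rw [← mul_rpow (by linarith [hz.2]) (by linarith [hz.1])]
  congr 1; ring

lemma Udom_meas : MeasurableSet Udom := by
  have : Udom = {x : ℝ × ℝ | x.1^2 ≤ x.2} ∩ {x | x.2 ≤ 1} := rfl
  rw [this]
  exact (measurableSet_le (by fun_prop) (by fun_prop)).inter (measurableSet_le (by fun_prop) (by fun_prop))

lemma Uw_meas (a b : ℝ) : Measurable (Uw a b) := by unfold Uw; fun_prop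

lemma Uw_nonneg {a b : ℝ} {z : ℝ × ℝ} (hz : z ∈ Udom) : 0 ≤ Uw a b z :=
  mul_nonneg (rpow_nonneg (by linarith [hz.2]) _) (rpow_nonneg (by linarith [hz.1]) _)

lemma lint_scale (a : ℝ) (ha : 0 < a) (h : ℝ → ℝ≥0∞) (hh : Measurable h) :
    ∫⁻ x, h x = ENNReal.ofReal a * ∫⁻ v, h (a * v) := by
  have := Real.smul_map_volume_mul_left ha.ne'
  conv_lhs => rw [← this]
  rw [lintegral_smul_measure, lintegral_map hh (by fun_prop), abs_of_pos ha, smul_eq_mul]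

lemma slice {d : ℕ} {β γ s : ℝ} (hs : s ∈ Ioc (0:ℝ) 1) (F : ℝ × ℝ → ℝ≥0∞) (hF : Measurable F) :
    ENNReal.ofReal (s ^ (((d:ℝ)-1)/2) * wt β γ s) *
      ∫⁻ v, F (√s * v, s) ∂(jM (β + ((d:ℝ)-2)/2) (β + ((d:ℝ)-2)/2)) ≤
    ∫⁻ x, Udom.indicator (fun z => ENNReal.ofReal (Uw γ (β + ((d:ℝ)-1)/2) z) * F z) (x, s) := by
  set ν := β + ((d:ℝ)-2)/2 with hν
  have hs0 := hs.1
  have hq : 0 < √s := Real.sqrt_pos.2 hs0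
  have hm : Measurable (Udom.indicator (fun z => ENNReal.ofReal (Uw γ (β + ((d:ℝ)-1)/2) z) * F z)) := by
    refine Measurable.indicator ?_ Udom_meas
    have := Uw_meas γ (β + ((d:ℝ)-1)/2)
    fun_prop
  rw [lint_scale (√s) hq _ (by fun_prop), jM_lintegral _ _ _ (by fun_prop), ← lintegral_const_mul _ (by have := jw_meas ν ν; fun_prop),
    ← lintegral_const_mul _ (by fun_prop), ← lintegral_indicator measurableSet_Ioc]
  apply lintegral_mono
  intro v
  by_cases hv : v ∈ Ioc (-1:ℝ) 1
  · have hv' : v ∈ Icc (-1:ℝ) 1 := ⟨hv.1.le, hv.2⟩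
    have hv2 : 0 ≤ 1 - v^2 := by nlinarith [hv.1, hv.2]
    have hsq : (√s * v)^2 = s * v^2 := by rw [mul_pow, Real.sq_sqrt hs0.le]
    have hmem : (√s * v, s) ∈ Udom := by
      refine ⟨?_, hs.2⟩
      simp only [hsq]
      nlinarith
    rw [indicator_of_mem hv]
    simp only [indicator_of_mem hmem]
    have hw0 : 0 ≤ s ^ (((d:ℝ)-1)/2) * wt β γ s := by
      unfold wt
      have := rpow_nonneg (by linarith [hs.2] : 0 ≤ 1 - s) γ
      positivity
    rw [← mul_assoc, ← mul_assoc, ← ENNReal.ofReal_mul hw0, ← ENNReal.ofReal_mul hq.le]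
    apply le_of_eq
    congr 2
    rw [jw_diag hv']
    simp only [Uw, wt, hsq]
    rw [show s - s * v^2 = s * (1 - v^2) by ring, mul_rpow hs0.le hv2,
      show β + ((d:ℝ)-1)/2 - 1/2 = ν by rw [hν]; ring]
    have : s ^ (((d:ℝ)-1)/2) * s^β = √s * s^ν := by
      rw [Real.sqrt_eq_rpow, ← rpow_add hs0, ← rpow_add hs0, hν]
      congr 1; ring
    linear_combination (1-s)^γ * (1-v^2)^ν * this
  · rw [indicator_of_notMem hv]; exact zero_le

lemma rhs_eq {a b : ℝ} (G : ℝ × ℝ → ℝ) (hi : Integrable G (μU a b)) :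
    ∫⁻ z in Udom, ENNReal.ofReal (Uw a b z) * ‖G z‖ₑ = ENNReal.ofReal (∫ z in Udom, |G z| * Uw a b z) := by
  have h1 : Integrable (fun z => |G z| * Uw a b z) (volume.restrict Udom) := by
    unfold μU at hi
    rw [integrable_withDensity_iff_integrable_smul' (by have := Uw_meas a b; fun_prop) (by simp)] at hi
    refine hi.norm.congr ?_
    filter_upwards [ae_restrict_mem Udom_meas] with z hz
    rw [norm_smul, ENNReal.toReal_ofReal (Uw_nonneg hz), Real.norm_of_nonneg (Uw_nonneg hz), mul_comm, Real.norm_eq_abs]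
  rw [ofReal_integral_eq_lintegral_ofReal h1]
  · apply setLIntegral_congr_fun Udom_meas
    intro z hz
    simp only
    rw [mul_comm, ENNReal.ofReal_mul (abs_nonneg _), ← Real.norm_eq_abs, ofReal_norm]
  · filter_upwards [ae_restrict_mem Udom_meas] with z hz
    exact mul_nonneg (abs_nonneg _) (Uw_nonneg hz)

lemma assemble {d : ℕ} {β γ k : ℝ} (hk : 0 ≤ k) (G : ℝ × ℝ → ℝ) (hG : Measurable G)
    (hi : Integrable G (μU γ (β + ((d:ℝ)-1)/2)))
    (T : ℝ → Metric.sphere (0 : Euc d) 1 → ℝ)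
    (hT : ∀ s ∈ Ioc (0:ℝ) 1, ∫⁻ η, ‖T s η‖ₑ ∂(sphMeas d) ≤
      ENNReal.ofReal k * ∫⁻ v, ‖G (√s * v, s)‖ₑ ∂(jM (β + ((d:ℝ)-2)/2) (β + ((d:ℝ)-2)/2))) :
    (∫ s in (0:ℝ)..1, s ^ (((d : ℝ) - 1)/2) * wt β γ s * ∫ η, |T s η| ∂(sphMeas d)) ≤
      k * ∫ z in Udom, |G z| * Uw γ (β + ((d : ℝ) - 1)/2) z := by
  set R := ∫ z in Udom, |G z| * Uw γ (β + ((d : ℝ) - 1)/2) z with hR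
  have hR0 : 0 ≤ R := setIntegral_nonneg Udom_meas (fun z hz => mul_nonneg (abs_nonneg _) (Uw_nonneg hz))
  rw [← ENNReal.ofReal_le_ofReal_iff (by positivity), ENNReal.ofReal_mul hk, hR, ← rhs_eq G hi,
    intervalIntegral.integral_of_le zero_le_one]
  have hm : Measurable (Udom.indicator (fun z => ENNReal.ofReal (Uw γ (β + ((d:ℝ)-1)/2) z) * ‖G z‖ₑ)) := by
    refine Measurable.indicator ?_ Udom_meas
    have := Uw_meas γ (β + ((d:ℝ)-1)/2)
    fun_prop
  refine (Real.ofReal_le_enorm _).trans ((enorm_integral_le_lintegral_enorm _).trans ?_)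
  calc _ ≤ ∫⁻ s in Ioc (0:ℝ) 1, ENNReal.ofReal k *
        ∫⁻ x, Udom.indicator (fun z => ENNReal.ofReal (Uw γ (β + ((d:ℝ)-1)/2) z) * ‖G z‖ₑ) (x, s) := by
        apply setLIntegral_mono' measurableSet_Ioc
        intro s hs
        have hw0 : 0 ≤ s ^ (((d:ℝ)-1)/2) * wt β γ s := by
          unfold wt
          have := rpow_nonneg (by linarith [hs.2] : 0 ≤ 1 - s) γ
          have := hs.1
          positivity
        rw [enorm_mul, Real.enorm_of_nonneg hw0]
        have h1 : ‖∫ η, |T s η| ∂(sphMeas d)‖ₑ ≤ ∫⁻ η, ‖T s η‖ₑ ∂(sphMeas d) := by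
          refine (enorm_integral_le_lintegral_enorm _).trans (le_of_eq ?_)
          congr 1; ext η; simp
        refine (mul_le_mul_right (h1.trans (hT s hs)) _).trans ?_
        rw [mul_left_comm]
        exact mul_le_mul_right (slice hs (fun z => ‖G z‖ₑ) (by fun_prop)) _
    _ ≤ ENNReal.ofReal k * ∫⁻ s, ∫⁻ x, Udom.indicator (fun z => ENNReal.ofReal (Uw γ (β + ((d:ℝ)-1)/2) z) * ‖G z‖ₑ) (x, s) := by
        rw [lintegral_const_mul _ (by exact hm.lintegral_prod_left')]
        exact mul_le_mul_right (setLIntegral_le_lintegral _ _) _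
    _ = _ := by
        congr 1
        rw [← lintegral_indicator Udom_meas, Measure.volume_eq_prod, lintegral_prod_symm' _ hm]

lemma T_one {d : ℕ} (hd : 2 ≤ d) {ξ : Euc d} (hξ : ‖ξ‖ = 1) (F : ℝ → ℝ≥0∞) (hF : Measurable F) :
    ∫⁻ η, F ⟪ξ, (η : Euc d)⟫ ∂(sphMeas d) =
      ENNReal.ofReal (ωd d / jJ (((d:ℝ)-3)/2) (((d:ℝ)-3)/2)) * ∫⁻ v, F v ∂(jM (((d:ℝ)-3)/2) (((d:ℝ)-3)/2)) := by
  rw [← smul_eq_mul, ← lintegral_smul_measure, ← push_one hd hξ, lintegral_map hF (by fun_prop)]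

lemma T_two {d : ℕ} (hd : 2 ≤ d) {β : ℝ} (hβ : -(1/2) < β) {ξ : Euc d} (hξ : ‖ξ‖ = 1) (H : ℝ → ℝ) (hH : Measurable H) :
    ∫⁻ η, ‖τβ d β * ∫ z₁ in (-1:ℝ)..1, ∫ z₂ in (-1:ℝ)..1, H ((1 - z₁) / 2 * ⟪ξ, (η : Euc d)⟫ + (1 + z₁) / 2 * z₂) *
      ((1 - z₁) ^ (((d : ℝ) - 2) / 2) * (1 + z₁) ^ (β - 1/2) * (1 - z₂ ^ 2) ^ β)‖ₑ ∂(sphMeas d) ≤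
    ENNReal.ofReal (|τβ d β| * (ωd d * jJ β β / jJ (β + ((d:ℝ)-2)/2) (β + ((d:ℝ)-2)/2) * jJ (((d:ℝ)-2)/2) (β-1/2))) *
      ∫⁻ v, ‖H v‖ₑ ∂(jM (β + ((d:ℝ)-2)/2) (β + ((d:ℝ)-2)/2)) := by
  have h2 : (2:ℝ) ≤ d := by exact_mod_cast hd
  have := jM_finite (by linarith : -1 < β) (by linarith : -1 < β)
  have := jM_finite (by linarith : -1 < ((d:ℝ)-2)/2) (by linarith : -1 < β - 1/2)
  have hp := phi_meas ξ
  rw [ENNReal.ofReal_mul (abs_nonneg _), mul_assoc, ← smul_eq_mul (ENNReal.ofReal (ωd d * _ / _ * _)), ← lintegral_smul_measure, ← push_two hd hβ hξ,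
    lintegral_map (by fun_prop) hp, lintegral_prod _ (by fun_prop), ← Real.norm_eq_abs, ofReal_norm,
    ← lintegral_const_mul']
  swap
  · simp
  apply lintegral_mono
  intro η
  beta_reduce
  rw [enorm_mul]
  apply mul_le_mul_right
  rw [lintegral_prod _ (by fun_prop), intervalIntegral.integral_of_le (by norm_num)]
  refine (enorm_integral_le_lintegral_enorm _).trans ?_
  have hm : Measurable (fun z₁ => ∫⁻ z₂, ‖H (phi ξ (η, z₁, z₂))‖ₑ ∂(jM β β)) := by
    apply Measurable.lintegral_prod_right' (f := fun z : ℝ × ℝ => ‖H (phi ξ (η, z.1, z.2))‖ₑ)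
    fun_prop
  rw [jM_lintegral _ _ _ hm]
  apply setLIntegral_mono' measurableSet_Ioc
  intro z₁ h₁
  rw [jM_lintegral _ _ _ (by fun_prop), intervalIntegral.integral_of_le (by norm_num), ← lintegral_const_mul' _ _ (by simp)]
  refine (enorm_integral_le_lintegral_enorm _).trans ?_
  apply setLIntegral_mono' measurableSet_Ioc
  intro z₂ h₂
  apply le_of_eq
  rw [← jw_diag ⟨h₂.1.le, h₂.2⟩, enorm_mul, enorm_mul, ← jw,
    Real.enorm_of_nonneg (jw_nonneg ⟨h₁.1.le, h₁.2⟩), Real.enorm_of_nonneg (jw_nonneg ⟨h₂.1.le, h₂.2⟩), mul_comm, mul_assoc]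
  rfl

/-- `L¹` boundedness of the operator `T_{β,γ}` on the surface of the paraboloid. -/
theorem stmt10 (d : ℕ) (hd : 2 ≤ d) (β γ : ℝ) (hβ : -(1/2) ≤ β) (hγ : -1 < γ) :
    ∃ c : ℝ, 0 < c ∧ ∀ g : ℝ × ℝ → ℝ × ℝ → ℝ, Measurable (Function.uncurry g) →
      (∀ t ∈ Set.Icc (0:ℝ) 1,
        Integrable (fun z => g (Real.sqrt t, t) z) (μU γ (β + ((d : ℝ) - 1)/2))) →
      ∀ ξ : Euc d, ‖ξ‖ = 1 → ∀ t ∈ Set.Icc (0:ℝ) 1,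
        (∫ s in (0:ℝ)..1, s ^ (((d : ℝ) - 1)/2) * wt β γ s *
            ∫ η, |TV0 d β γ g ξ (η : Euc d) t s| ∂(sphMeas d)) ≤
          c * ∫ z in Udom, |g (Real.sqrt t, t) z| * Uw γ (β + ((d : ℝ) - 1)/2) z := by
  have h2 : (2:ℝ) ≤ d := by exact_mod_cast hd
  have hω : 0 ≤ ωd d := ENNReal.toReal_nonneg
  have key : ∃ k : ℝ, 0 ≤ k ∧ ∀ G : ℝ × ℝ → ℝ × ℝ → ℝ, Measurable (Function.uncurry G) → ∀ ξ : Euc d, ‖ξ‖ = 1 → ∀ t s : ℝ,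
      ∫⁻ η, ‖TV0 d β γ G ξ (η : Metric.sphere (0 : Euc d) 1) t s‖ₑ ∂(sphMeas d) ≤
      ENNReal.ofReal k * ∫⁻ v, ‖G (√t, t) (√s * v, s)‖ₑ ∂(jM (β + ((d:ℝ)-2)/2) (β + ((d:ℝ)-2)/2)) := by
    by_cases hb : β = -(1/2)
    · have hJ := jJ_pos (by linarith : -1 < ((d:ℝ)-3)/2) (by linarith : -1 < ((d:ℝ)-3)/2)
      refine ⟨ωd d / jJ (((d:ℝ)-3)/2) (((d:ℝ)-3)/2), by positivity, ?_⟩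
      intro G hG ξ hξ t s
      have hm : Measurable (fun v => ‖G (√t, t) (√s * v, s)‖ₑ) := by
        have : Measurable (fun v : ℝ => Function.uncurry G ((√t, t), (√s * v, s))) := hG.comp (by fun_prop)
        exact this.enorm
      rw [show β + ((d:ℝ)-2)/2 = ((d:ℝ)-3)/2 by rw [hb]; ring, ← T_one hd hξ _ hm]
      simp only [TV0, if_pos hb, inner_smul_right]
      exact le_rfl
    · have hb' : -(1/2) < β := lt_of_le_of_ne hβ (Ne.symm hb)
      have hJ := jJ_pos (by linarith : -1 < β + ((d:ℝ)-2)/2) (by linarith : -1 < β + ((d:ℝ)-2)/2)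
      have hJb := jJ_pos (by linarith : -1 < β) (by linarith : -1 < β)
      have hJl := jJ_pos (by linarith : -1 < ((d:ℝ)-2)/2) (by linarith : -1 < β - 1/2)
      refine ⟨|τβ d β| * (ωd d * jJ β β / jJ (β + ((d:ℝ)-2)/2) (β + ((d:ℝ)-2)/2) * jJ (((d:ℝ)-2)/2) (β-1/2)), by positivity, ?_⟩
      · intro G hG ξ hξ t s
        have hm : Measurable (fun v => G (√t, t) (√s * v, s)) :=
          hG.comp (f := fun v : ℝ => ((√t, t), (√s * v, s))) (by fun_prop)
        have := T_two hd hb' hξ _ hm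
        simp only [TV0, if_neg hb]
        exact this
  obtain ⟨k, hk, key⟩ := key
  refine ⟨k + 1, by positivity, ?_⟩
  intro g hg hi ξ hξ t ht
  have hG : Measurable (fun z => g (√t, t) z) := hg.comp (f := fun z => ((√t, t), z)) (by fun_prop)
  refine (assemble hk (fun z => g (√t, t) z) hG (hi t ht) (fun s η => TV0 d β γ g ξ (η : Euc d) t s)
    (fun s _ => key g hg ξ hξ t s)).trans ?_
  apply mul_le_mul_of_nonneg_right (by linarith)
  exact setIntegral_nonneg Udom_meas (fun z hz => mul_nonneg (abs_nonneg _) (Uw_nonneg hz))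
end

section
/- Let d≥2, μ>0 and v∈𝔹^d. Then for every continuous function h:[-1,1]→ℝ: σ_μ·b_μ·∫_{𝔹^d}∫_{-1}^1 h(⟨u,v⟩ + r·√(1-‖u‖²)·√(1-‖v‖²))·(1-r²)^{μ-1} dr·(1-‖u‖²)^{μ-1/2} du = c'·∫_{-1}^1 h(t)·(1-t²)^{μ+(d-2)/2} dt, where σ_μ = (∫_{-1}^1 (1-r²)^{μ-1} dr)^{-1}, b_μ = (∫_{𝔹^d} (1-‖u‖²)^{μ-1/2} du)^{-1}, and c' = (∫_{-1}^1 (1-t²)^{μ+(d-2)/2} dt)^{-1}. -/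
open MeasureTheory Real Filter Set
open scoped RealInnerProductSpace ENNReal

noncomputable def gw (μ s : ℝ) : ℝ := if s < 1 then (1 - s) ^ (μ - 1) else 0

theorem gw_nonneg (μ s : ℝ) : 0 ≤ gw μ s := by
  unfold gw; split_ifs with h
  · exact rpow_nonneg (by linarith) _
  · exact le_rfl

theorem gw_measurable (μ : ℝ) : Measurable (gw μ) := by
  unfold gw
  exact Measurable.ite measurableSet_Iio (by fun_prop) measurable_const

theorem gw_scale (μ : ℝ) {c s : ℝ} (hc : 0 < c) : gw μ (1 - c + c * s) = c ^ (μ - 1) * gw μ s := by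
  unfold gw
  have : (1 - c + c * s < 1) ↔ s < 1 := by
    constructor <;> intro h <;> nlinarith
  simp only [this]
  split_ifs with h
  · rw [← mul_rpow hc.le (by linarith)]; congr 1; ring
  · simp

theorem gw_radial {μ : ℝ} (hμ : 0 < μ) {E : Type*} [NormedAddCommGroup E] [InnerProductSpace ℝ E]
    [FiniteDimensional ℝ E] [MeasurableSpace E] [BorelSpace E] [Nontrivial E] :
    Integrable (fun x : E => gw μ (‖x‖ ^ 2)) := by
  rw [integrable_fun_norm_addHaar (volume : Measure E) (f := fun y => gw μ (y ^ 2))]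
  have hb : IntegrableOn (fun y : ℝ => (1 - y) ^ (μ - 1)) (Ioo 0 1) := by
    have h1 : IntervalIntegrable (fun y : ℝ => y ^ (μ - 1)) volume 0 1 :=
      intervalIntegral.intervalIntegrable_rpow' (by linarith)
    have h2 := (h1.comp_sub_left 1).symm
    simp only [sub_self, sub_zero] at h2
    rw [intervalIntegrable_iff_integrableOn_Ioo_of_le (by norm_num)] at h2
    exact h2
  have hb2 : IntegrableOn (fun y : ℝ => (2 ^ |μ - 1|) * (1 - y) ^ (μ - 1)) (Ioo 0 1) :=
    hb.const_mul _
  have hb3 : Integrable ((Ioo (0:ℝ) 1).indicator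
      (fun y : ℝ => (2 ^ |μ - 1|) * (1 - y) ^ (μ - 1))) :=
    (integrable_indicator_iff measurableSet_Ioo).2 hb2
  refine Integrable.mono' hb3.integrableOn ?_ ?_
  · exact ((measurable_id.pow_const _).mul
      ((gw_measurable μ).comp (measurable_id.pow_const 2))).aestronglyMeasurable
  · rw [ae_restrict_iff' measurableSet_Ioi]
    refine Eventually.of_forall fun y hy => ?_
    have hy0 : 0 < y := hy
    by_cases h1 : y < 1
    · have hy2 : y ^ 2 < 1 := by nlinarith
      rw [indicator_of_mem (show y ∈ Ioo (0:ℝ) 1 from ⟨hy0, h1⟩)]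
      simp only [gw, hy2, if_true, smul_eq_mul]
      have e : (1 - y ^ 2) ^ (μ - 1) = (1 + y) ^ (μ - 1) * (1 - y) ^ (μ - 1) := by
        rw [← mul_rpow (by linarith) (by linarith)]; congr 1; ring
      have p1 : 0 ≤ (1 + y) ^ (μ - 1) := rpow_nonneg (by linarith) _
      have p2 : 0 ≤ (1 - y) ^ (μ - 1) := rpow_nonneg (by linarith) _
      have b1 : (1 + y) ^ (μ - 1) ≤ 2 ^ |μ - 1| :=
        (rpow_le_rpow_of_exponent_le (by linarith) (le_abs_self _)).trans
          (rpow_le_rpow (by linarith) (by linarith) (abs_nonneg _))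
      have b2 : y ^ (Module.finrank ℝ E - 1) ≤ 1 := pow_le_one₀ hy0.le h1.le
      rw [e, Real.norm_of_nonneg (by positivity)]
      calc _ ≤ 1 * ((1 + y) ^ (μ - 1) * (1 - y) ^ (μ - 1)) := by gcongr
        _ ≤ _ := by rw [one_mul]; gcongr
    · have hy2 : ¬ y ^ 2 < 1 := by nlinarith
      rw [indicator_of_notMem (by simp [h1])]
      simp [gw, hy2]

theorem gw_radial_pos {μ : ℝ} (hμ : 0 < μ) {E : Type*} [NormedAddCommGroup E]
    [InnerProductSpace ℝ E]
    [FiniteDimensional ℝ E] [MeasurableSpace E] [BorelSpace E] [Nontrivial E] :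
    0 < ∫ x : E, gw μ (‖x‖ ^ 2) := by
  rw [integral_pos_iff_support_of_nonneg (fun x => gw_nonneg _ _) (gw_radial hμ)]
  refine (Metric.measure_ball_pos volume (0:E) one_pos).trans_le (measure_mono fun x hx => ?_)
  have hx1 : ‖x‖ < 1 := by simpa using hx
  have : ‖x‖ ^ 2 < 1 := by nlinarith [norm_nonneg x]
  simp only [Function.mem_support, gw, this, if_true]
  exact (rpow_pos_of_pos (by linarith) _).ne'

theorem int_interval_gw (μ : ℝ) (F : ℝ → ℝ) :
    ∫ r in (-1:ℝ)..1, F r * (1 - r ^ 2) ^ (μ - 1) = ∫ r, F r * gw μ (r ^ 2) := by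
  rw [intervalIntegral.integral_of_le (by norm_num), integral_Ioc_eq_integral_Ioo,
    ← integral_indicator measurableSet_Ioo]
  congr 1; ext r
  by_cases hr : r ∈ Ioo (-1:ℝ) 1
  · have : r ^ 2 < 1 := by nlinarith [hr.1, hr.2]
    simp [hr, gw, this]
  · have : ¬ r ^ 2 < 1 := fun h => hr (abs_lt.1 ((sq_lt_one_iff_abs_lt_one r).1 h))
    rw [indicator_of_notMem hr]
    simp [gw, this]

abbrev EE (d : ℕ) := WithLp 2 (Euc d × ℝ)

/-- rotation invariance -/
theorem rot (d : ℕ) (f g : ℝ → ℝ) (V W : EE d) (h : ‖V‖ = ‖W‖) :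
    ∫ X : EE d, f ⟪X, V⟫ * g (‖X‖ ^ 2) = ∫ X : EE d, f ⟪X, W⟫ * g (‖X‖ ^ 2) := by
  have hr := Submodule.reflection_sub h
  set R := Submodule.reflection (ℝ ∙ (V - W))ᗮ
  rw [← (R.measurePreserving).integral_comp R.toHomeomorph.measurableEmbedding
    (fun X => f ⟪X, W⟫ * g (‖X‖ ^ 2))]
  congr 1; ext X
  rw [← hr]
  simp

theorem toProd (d : ℕ) (F : Euc d × ℝ → ℝ) :
    ∫ X : EE d, F (WithLp.ofLp X) = ∫ p : Euc d × ℝ, F p := by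
  exact (WithLp.volume_preserving_ofLp (Euc d) ℝ).integral_comp
    (MeasurableEquiv.toLp 2 (Euc d × ℝ)).symm.measurableEmbedding F

theorem P_integrable (d : ℕ) {μ : ℝ} (hμ : 0 < μ) (H : ℝ → ℝ) (hH : Continuous H) (M : ℝ)
    (hM : ∀ x, ‖H x‖ ≤ M) (v : Euc d) (s : ℝ) :
    Integrable (fun p : Euc d × ℝ => H (⟪p.1, v⟫ + p.2 * s) * gw μ (‖p.1‖ ^ 2 + p.2 ^ 2)) := by
  have hg : Integrable (fun p : Euc d × ℝ => gw μ (‖p.1‖ ^ 2 + p.2 ^ 2)) := by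
    rw [← (WithLp.volume_preserving_ofLp (Euc d) ℝ).integrable_comp_emb
      (MeasurableEquiv.toLp 2 (Euc d × ℝ)).symm.measurableEmbedding]
    have : Nontrivial (EE d) :=
      ⟨⟨WithLp.toLp 2 (0, 0), WithLp.toLp 2 (0, 1), fun h => by
        have := congrArg (fun x : EE d => x.snd) h
        simp at this⟩⟩
    have := gw_radial hμ (E := EE d)
    refine this.congr (Eventually.of_forall fun X => ?_)
    simp [WithLp.prod_norm_sq_eq_of_L2]
  refine hg.bdd_mul (c := M) ?_ (Eventually.of_forall fun p => hM _)
  exact (hH.comp (by fun_prop)).aestronglyMeasurable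

theorem P_rot (d : ℕ) (μ : ℝ) (H : ℝ → ℝ) (v : Euc d) (hv : ‖v‖ ≤ 1) :
    ∫ p : Euc d × ℝ, H (⟪p.1, v⟫ + p.2 * √(1 - ‖v‖ ^ 2)) * gw μ (‖p.1‖ ^ 2 + p.2 ^ 2) =
    ∫ p : Euc d × ℝ, H (⟪p.1, (0 : Euc d)⟫ + p.2 * 1) * gw μ (‖p.1‖ ^ 2 + p.2 ^ 2) := by
  have hn : ‖(WithLp.toLp 2 (v, √(1 - ‖v‖ ^ 2)) : EE d)‖ = ‖(WithLp.toLp 2 (0, 1) : EE d)‖ := by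
    rw [← sq_eq_sq₀ (norm_nonneg _) (norm_nonneg _), WithLp.prod_norm_sq_eq_of_L2,
      WithLp.prod_norm_sq_eq_of_L2]
    simp
    rw [sq_sqrt (by nlinarith [norm_nonneg v])]; ring
  have := rot d H (gw μ) _ _ hn
  rw [← toProd, ← toProd]
  convert this using 3 with X X
  · simp [WithLp.prod_norm_sq_eq_of_L2, WithLp.prod_inner_apply, mul_comm]
  · simp [WithLp.prod_norm_sq_eq_of_L2, WithLp.prod_inner_apply, mul_comm]

theorem P_left (d : ℕ) (hd : 1 ≤ d) {μ : ℝ} (hμ : 0 < μ) (H : ℝ → ℝ) (hH : Continuous H) (M : ℝ)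
    (hM : ∀ x, ‖H x‖ ≤ M) (v : Euc d) (s : ℝ) :
    ∫ p : Euc d × ℝ, H (⟪p.1, v⟫ + p.2 * s) * gw μ (‖p.1‖ ^ 2 + p.2 ^ 2) =
    ∫ u in Metric.closedBall (0 : Euc d) 1,
          (∫ r in (-1:ℝ)..1,
            H (⟪u, v⟫ + r * Real.sqrt (1 - ‖u‖ ^ 2) * s) *
              (1 - r ^ 2) ^ (μ - 1)) * (1 - ‖u‖ ^ 2) ^ (μ - 1/2) := by
  have : Nonempty (Fin d) := ⟨⟨0, hd⟩⟩
  rw [Measure.volume_eq_prod, integral_prod _ (P_integrable d hμ H hH M hM v s)]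
  have hs : (Metric.closedBall (0 : Euc d) 1) =ᵐ[volume] (Metric.ball (0 : Euc d) 1) := by
    rw [← Metric.ball_union_sphere]
    exact union_ae_eq_left_of_ae_eq_empty (ae_eq_empty.2 (Measure.addHaar_sphere _ _ _))
  rw [setIntegral_congr_set hs, ← integral_indicator measurableSet_ball]
  congr 1; ext u
  by_cases hu : ‖u‖ < 1
  · have hc : 0 < 1 - ‖u‖ ^ 2 := by nlinarith [norm_nonneg u]
    rw [indicator_of_mem (by simpa using hu),
      int_interval_gw μ (fun r => H (⟪u, v⟫ + r * Real.sqrt (1 - ‖u‖ ^ 2) * s))]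
    set c := 1 - ‖u‖ ^ 2 with hcd
    have hq : 0 < √c := sqrt_pos.2 hc
    have h1 := Measure.integral_comp_mul_left
      (fun y => H (⟪u, v⟫ + y * s) * gw μ (‖u‖ ^ 2 + y ^ 2)) (√c)
    have h2 : ∀ r : ℝ, gw μ (‖u‖ ^ 2 + (√c * r) ^ 2) = c ^ (μ - 1) * gw μ (r ^ 2) := by
      intro r
      rw [← gw_scale μ hc, mul_pow, sq_sqrt hc.le]
      congr 1; rw [hcd]; ring
    simp only [h2] at h1
    have h3 : ∫ r, H (⟪u, v⟫ + √c * r * s) * (c ^ (μ - 1) * gw μ (r ^ 2)) =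
        c ^ (μ - 1) * ∫ r, H (⟪u, v⟫ + r * √c * s) * gw μ (r ^ 2) := by
      rw [← integral_const_mul]; congr 1; ext r; rw [mul_comm (√c) r]; ring
    rw [h3, abs_of_pos (inv_pos.2 hq), smul_eq_mul] at h1
    have h4 : c ^ (μ - 1/2) = √c * c ^ (μ - 1) := by
      rw [sqrt_eq_rpow, ← rpow_add hc]; congr 1; ring
    rw [h4, mul_comm, mul_assoc, h1, ← mul_assoc, mul_inv_cancel₀ hq.ne', one_mul]
  · rw [indicator_of_notMem (by simpa using hu)]
    have : ∀ y : ℝ, ¬ (‖u‖ ^ 2 + y ^ 2 < 1) := fun y => by nlinarith [sq_nonneg y]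
    simp [gw, this]

theorem P_right (d : ℕ) {μ : ℝ} (hμ : 0 < μ) (H : ℝ → ℝ) (hH : Continuous H) (M : ℝ)
    (hM : ∀ x, ‖H x‖ ≤ M) :
    ∫ p : Euc d × ℝ, H (⟪p.1, (0 : Euc d)⟫ + p.2 * 1) * gw μ (‖p.1‖ ^ 2 + p.2 ^ 2) =
    (∫ w : Euc d, gw μ (‖w‖ ^ 2)) *
      ∫ t in (-1:ℝ)..1, H t * (1 - t ^ 2) ^ (μ + ((d : ℝ) - 2)/2) := by
  rw [Measure.volume_eq_prod, integral_prod_symm _ (P_integrable d hμ H hH M hM 0 1)]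
  rw [intervalIntegral.integral_of_le (by norm_num), integral_Ioc_eq_integral_Ioo,
    ← integral_indicator measurableSet_Ioo, ← integral_const_mul]
  congr 1; ext y
  simp only [inner_zero_right, zero_add, mul_one]
  rw [integral_const_mul]
  by_cases hy : y ∈ Ioo (-1:ℝ) 1
  · have hc : 0 < 1 - y ^ 2 := by nlinarith [hy.1, hy.2]
    rw [indicator_of_mem hy]
    set c := 1 - y ^ 2 with hcd
    have hq : 0 < √c := sqrt_pos.2 hc
    have h1 := Measure.integral_comp_smul (volume : Measure (Euc d))
      (fun u => gw μ (‖u‖ ^ 2 + y ^ 2)) (√c)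
    have h2 : ∀ w : Euc d, gw μ (‖√c • w‖ ^ 2 + y ^ 2) = c ^ (μ - 1) * gw μ (‖w‖ ^ 2) := by
      intro r
      rw [← gw_scale μ hc, norm_smul, mul_pow, norm_of_nonneg hq.le, sq_sqrt hc.le]
      congr 1; rw [hcd]; ring
    simp only [h2] at h1
    rw [integral_const_mul, abs_of_pos (inv_pos.2 (pow_pos hq _)), smul_eq_mul,
      finrank_euclideanSpace_fin] at h1
    have h4 : c ^ (μ + ((d : ℝ) - 2)/2) = √c ^ d * c ^ (μ - 1) := by
      rw [sqrt_eq_rpow, ← rpow_natCast, ← rpow_mul hc.le, ← rpow_add hc]; congr 1; ring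
    have h5 : ∫ u : Euc d, gw μ (‖u‖ ^ 2 + y ^ 2) =
        √c ^ d * (c ^ (μ - 1) * ∫ w : Euc d, gw μ (‖w‖ ^ 2)) := by
      rw [h1, mul_inv_cancel_left₀ (pow_pos hq _).ne']
    rw [h4, h5]; ring
  · rw [indicator_of_notMem hy]
    have h0 : ¬ y ^ 2 < 1 := fun h => hy (abs_lt.1 ((sq_lt_one_iff_abs_lt_one y).1 h))
    have : ∀ u : Euc d, ¬ (‖u‖ ^ 2 + y ^ 2 < 1) := fun u => by nlinarith [sq_nonneg ‖u‖]
    simp [gw, this]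

theorem key (d : ℕ) (hd : 1 ≤ d) {μ : ℝ} (hμ : 0 < μ) (H : ℝ → ℝ) (hH : Continuous H) (M : ℝ)
    (hM : ∀ x, ‖H x‖ ≤ M) (v : Euc d) (hv : ‖v‖ ≤ 1) :
    ∫ u in Metric.closedBall (0 : Euc d) 1,
          (∫ r in (-1:ℝ)..1,
            H (⟪u, v⟫ + r * Real.sqrt (1 - ‖u‖ ^ 2) * Real.sqrt (1 - ‖v‖ ^ 2)) *
              (1 - r ^ 2) ^ (μ - 1)) * (1 - ‖u‖ ^ 2) ^ (μ - 1/2) =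
    (∫ w : Euc d, gw μ (‖w‖ ^ 2)) *
      ∫ t in (-1:ℝ)..1, H t * (1 - t ^ 2) ^ (μ + ((d : ℝ) - 2)/2) := by
  rw [← P_left d hd hμ H hH M hM, P_rot d μ H v hv, P_right d hμ H hH M hM]

theorem arg_mem (d : ℕ) (u v : Euc d) (hu : ‖u‖ ≤ 1) (hv : ‖v‖ ≤ 1) (r : ℝ)
    (hr : r ∈ Icc (-1:ℝ) 1) :
    ⟪u, v⟫ + r * Real.sqrt (1 - ‖u‖ ^ 2) * Real.sqrt (1 - ‖v‖ ^ 2) ∈ Icc (-1:ℝ) 1 := by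
  have h1 := abs_real_inner_le_norm u v
  have a1 : √(1 - ‖u‖ ^ 2) ^ 2 = 1 - ‖u‖ ^ 2 := sq_sqrt (by nlinarith [norm_nonneg u])
  have a2 : √(1 - ‖v‖ ^ 2) ^ 2 = 1 - ‖v‖ ^ 2 := sq_sqrt (by nlinarith [norm_nonneg v])
  have p1 := sqrt_nonneg (1 - ‖u‖ ^ 2)
  have p2 := sqrt_nonneg (1 - ‖v‖ ^ 2)
  set a := √(1 - ‖u‖ ^ 2)
  set b := √(1 - ‖v‖ ^ 2)
  have h2 : |r * a * b| ≤ a * b := by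
    rw [mul_assoc, abs_mul, abs_of_nonneg (mul_nonneg p1 p2)]
    exact mul_le_of_le_one_left (mul_nonneg p1 p2) (abs_le.2 hr)
  have h3 : ‖u‖ * ‖v‖ + a * b ≤ 1 := by nlinarith [sq_nonneg (‖u‖ - ‖v‖), sq_nonneg (a - b)]
  exact abs_le.1 ((abs_add_le _ _).trans (by linarith))

/-- the ball-to-interval integral identity. -/
theorem stmt18 (d : ℕ) (hd : 2 ≤ d) (μ : ℝ) (hμ : 0 < μ) (v : Euc d)
    (hv : v ∈ Metric.closedBall (0 : Euc d) 1) (h : ℝ → ℝ)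
    (hh : ContinuousOn h (Set.Icc (-1:ℝ) 1)) :
    σμ μ * bB d μ *
        ∫ u in Metric.closedBall (0 : Euc d) 1,
          (∫ r in (-1:ℝ)..1,
            h (⟪u, v⟫ + r * Real.sqrt (1 - ‖u‖ ^ 2) * Real.sqrt (1 - ‖v‖ ^ 2)) *
              (1 - r ^ 2) ^ (μ - 1)) * (1 - ‖u‖ ^ 2) ^ (μ - 1/2) =
      (∫ t in (-1:ℝ)..1, (1 - t ^ 2) ^ (μ + ((d : ℝ) - 2)/2))⁻¹ *
        ∫ t in (-1:ℝ)..1, h t * (1 - t ^ 2) ^ (μ + ((d : ℝ) - 2)/2) := by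

  have hv1 : ‖v‖ ≤ 1 := by simpa using hv
  have hd1 : 1 ≤ d := by omega
  have : Nonempty (Fin d) := ⟨⟨0, hd1⟩⟩
  have hle : (-1:ℝ) ≤ 1 := by norm_num
  set H : ℝ → ℝ := IccExtend hle ((Icc (-1:ℝ) 1).domRestrict h) with hHdef
  have hHc : Continuous H := hh.domRestrict.Icc_extend'
  have hHe : ∀ x ∈ Icc (-1:ℝ) 1, H x = h x := fun x hx => by
    rw [hHdef, IccExtend_of_mem _ _ hx]; rfl
  obtain ⟨M, hM⟩ := isCompact_Icc.exists_bound_of_continuousOn hh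
  have hHM : ∀ x, ‖H x‖ ≤ M := fun x => hM _ (projIcc (-1) 1 hle x).2
  have k1 := key d hd1 hμ H hHc M hHM v hv1
  have k2 := key d hd1 hμ (fun _ => 1) continuous_const 1 (fun _ => by simp) v hv1
  have e1 : ∫ u in Metric.closedBall (0 : Euc d) 1,
          (∫ r in (-1:ℝ)..1,
            h (⟪u, v⟫ + r * Real.sqrt (1 - ‖u‖ ^ 2) * Real.sqrt (1 - ‖v‖ ^ 2)) *
              (1 - r ^ 2) ^ (μ - 1)) * (1 - ‖u‖ ^ 2) ^ (μ - 1/2) =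
      ∫ u in Metric.closedBall (0 : Euc d) 1,
          (∫ r in (-1:ℝ)..1,
            H (⟪u, v⟫ + r * Real.sqrt (1 - ‖u‖ ^ 2) * Real.sqrt (1 - ‖v‖ ^ 2)) *
              (1 - r ^ 2) ^ (μ - 1)) * (1 - ‖u‖ ^ 2) ^ (μ - 1/2) := by
    refine setIntegral_congr_fun Metric.isClosed_closedBall.measurableSet fun u hu => ?_
    have hu1 : ‖u‖ ≤ 1 := by simpa using hu
    congr 1
    refine intervalIntegral.integral_congr fun r hr => ?_
    rw [uIcc_of_le hle] at hr
    beta_reduce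
    rw [hHe _ (arg_mem d u v hu1 hv1 r hr)]
  have e2 : ∫ t in (-1:ℝ)..1, h t * (1 - t ^ 2) ^ (μ + ((d : ℝ) - 2)/2) =
      ∫ t in (-1:ℝ)..1, H t * (1 - t ^ 2) ^ (μ + ((d : ℝ) - 2)/2) := by
    refine intervalIntegral.integral_congr fun r hr => ?_
    rw [uIcc_of_le hle] at hr
    beta_reduce
    rw [hHe _ hr]
  rw [e1, e2, k1]
  simp only [one_mul] at k2
  rw [integral_const_mul] at k2
  have hC : 0 < ∫ w : Euc d, gw μ (‖w‖ ^ 2) := gw_radial_pos hμ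
  have hexp : 0 < μ + ((d : ℝ) - 2)/2 := by
    have : (2:ℝ) ≤ d := by exact_mod_cast hd
    linarith
  have hI : 0 < ∫ t in (-1:ℝ)..1, (1 - t ^ 2) ^ (μ + ((d : ℝ) - 2)/2) := by
    refine intervalIntegral.intervalIntegral_pos_of_pos_on ?_ ?_ (by norm_num)
    · exact (Continuous.rpow_const (by fun_prop) fun _ => Or.inr hexp.le).intervalIntegrable _ _
    · intro t ht
      exact rpow_pos_of_pos (by nlinarith [ht.1, ht.2]) _
  have hk : σμ μ * bB d μ = ((∫ w : Euc d, gw μ (‖w‖ ^ 2)) *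
      ∫ t in (-1:ℝ)..1, (1 - t ^ 2) ^ (μ + ((d : ℝ) - 2)/2))⁻¹ := by
    rw [← k2, mul_inv]; rfl
  rw [hk]
  field_simp
end
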